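/- arXiv:1712.05549 — 2 statements merged into one kernel-verified Lean document; each statement's English description precedes it below -/
import Mathlib

section
/- Let d ≥ 8 be an even integer. There exists a constant C = C(d) > 0 such that for every finite field F of odd characteristic, every nontrivial additive character e of F, and every function f : P → ℂ on the paraboloid P ⊆ F^d, one has ‖(f dσ)^∨‖_{L^{(2d+4)/d}(F^d)} ≤ C ‖f‖_{L^2(P,dσ)}, i.e. (∑_{x∈F^d} |(f dσ)^∨(x)|^{(2d+4)/d})^{d/(2d+4)} ≤ C (|F|^{-(d-1)} ∑_{ξ∈P} |f(ξ)|²)^{1/2}. -/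
open Finset

/-- The finite field extension operator for the paraboloid
`P = {(x̄, x̄·x̄) : x̄ ∈ F^{d-1}} ⊆ F^d`, where a point of `F^d` is modeled as a pair
`(x̄, x_d) ∈ F^{d-1} × F` and a function on `P` is parameterized by `x̄ ∈ F^{d-1}`:
`(f dσ)^∨(x) = |F|^{-(d-1)} ∑_{ξ ∈ P} f(ξ) e(x·ξ)`. -/
noncomputable def extOp {F : Type} [Field F] [Fintype F] {d : ℕ} (e : AddChar F ℂ)
    (f : (Fin (d - 1) → F) → ℂ) (x : (Fin (d - 1) → F) × F) : ℂ :=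
  ((Fintype.card F : ℂ) ^ (d - 1))⁻¹ *
    ∑ y : Fin (d - 1) → F, f y * e (∑ i, x.1 i * y i + x.2 * ∑ i, y i * y i)

namespace ParaboloidRestriction

section Orthogonality

variable {X V J : Type*} [Fintype X] [DecidableEq V]

/-- Expansion of `∑ₓ |∑ⱼ cⱼ χ(x, φⱼ)|²` for a kernel `χ` with orthogonal columns. -/
theorem sum_norm_sq_eq (χ : X → V → ℂ) (Q : ℝ)
    (h : ∀ v w, ∑ x, χ x v * (starRingEnd ℂ) (χ x w) = if v = w then (Q : ℂ) else 0)
    (s : Finset J) (c : J → ℂ) (φ : J → V) :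
    ((∑ x, ‖∑ j ∈ s, c j * χ x (φ j)‖ ^ 2 : ℝ) : ℂ) =
      Q * ∑ i ∈ s, ∑ j ∈ s, if φ i = φ j then c i * (starRingEnd ℂ) (c j) else 0 := by
  push_cast
  simp_rw [← Complex.mul_conj', map_sum, sum_mul_sum]
  rw [sum_comm]
  simp_rw [mul_sum]
  refine sum_congr rfl fun i _ ↦ ?_
  rw [sum_comm]
  refine sum_congr rfl fun j _ ↦ ?_
  calc _ = ∑ x, c i * (starRingEnd ℂ) (c j) * (χ x (φ i) * (starRingEnd ℂ) (χ x (φ j))) :=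
        sum_congr rfl fun x _ ↦ by rw [map_mul]; ring
    _ = _ := by
        rw [← mul_sum, h]
        split_ifs <;> ring

theorem sum_norm_sq_le (χ : X → V → ℂ) {Q : ℝ} (hQ : 0 ≤ Q)
    (h : ∀ v w, ∑ x, χ x v * (starRingEnd ℂ) (χ x w) = if v = w then (Q : ℂ) else 0)
    (s : Finset J) (c : J → ℂ) (hc : ∀ j ∈ s, ‖c j‖ ≤ 1) (φ : J → V) :
    ∑ x, ‖∑ j ∈ s, c j * χ x (φ j)‖ ^ 2 ≤ Q * #{p ∈ s ×ˢ s | φ p.1 = φ p.2} := by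
  have h1 := congrArg norm (sum_norm_sq_eq χ Q h s c φ)
  rw [Complex.norm_real, Real.norm_of_nonneg (by positivity), norm_mul, Complex.norm_real,
    Real.norm_of_nonneg hQ] at h1
  rw [h1]
  gcongr
  rw [← sum_product', card_filter]
  push_cast
  refine (norm_sum_le _ _).trans (sum_le_sum fun p hp ↦ ?_)
  rw [mem_product] at hp
  split_ifs
  · rw [norm_mul, RCLike.norm_conj]
    exact mul_le_one₀ (hc _ hp.1) (norm_nonneg _) (hc _ hp.2)
  · simp

theorem sum_norm_sq_univ [Fintype V] (χ : X → V → ℂ) (Q : ℝ)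
    (h : ∀ v w, ∑ x, χ x v * (starRingEnd ℂ) (χ x w) = if v = w then (Q : ℂ) else 0)
    (s : Finset V) (c : V → ℂ) :
    ∑ x, ‖∑ v ∈ s, c v * χ x v‖ ^ 2 = Q * ∑ v ∈ s, ‖c v‖ ^ 2 := by
  have h1 := sum_norm_sq_eq χ Q h s c id
  have h2 : ∀ i ∈ s, (∑ j ∈ s, if id i = id j then c i * (starRingEnd ℂ) (c j) else 0) =
      (‖c i‖ : ℂ) ^ 2 := fun i hi ↦ by
    simp only [id]
    rw [sum_ite_eq, if_pos hi, Complex.mul_conj']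
  rw [sum_congr rfl h2] at h1
  exact_mod_cast h1

end Orthogonality

section Characters

variable {F : Type} [Field F] [Fintype F] [DecidableEq F] {e : AddChar F ℂ}

theorem sum_char_mul (he : e ≠ 1) (b : F) :
    ∑ x, e (x * b) = if b = 0 then (Fintype.card F : ℂ) else 0 := by
  rw [AddChar.sum_mulShift b (AddChar.IsPrimitive.of_ne_one he)]
  split_ifs <;> simp

theorem char_sum_eq_prod {A ι : Type*} [AddCommMonoid A] (ψ : AddChar A ℂ) (s : Finset ι)
    (f : ι → A) : ψ (∑ i ∈ s, f i) = ∏ i ∈ s, ψ (f i) := by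
  classical
  induction s using Finset.induction_on with
  | empty => simp
  | insert a s ha ih => rw [sum_insert ha, prod_insert ha, AddChar.map_add_eq_mul, ih]

theorem sum_char_dotProduct (he : e ≠ 1) {ι : Type} [Fintype ι] [DecidableEq ι] (v : ι → F) :
    ∑ ξ : ι → F, e (ξ ⬝ᵥ v) = if v = 0 then (Fintype.card F : ℂ) ^ Fintype.card ι else 0 := by
  simp_rw [dotProduct, char_sum_eq_prod]
  rw [← Fintype.piFinset_univ, ← prod_univ_sum (fun _ ↦ univ) fun i x ↦ e (x * v i)]
  simp_rw [sum_char_mul he]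
  split_ifs with h
  · simp [h]
  · obtain ⟨i, hi⟩ := Function.ne_iff.mp h
    exact prod_eq_zero (mem_univ i) (if_neg hi)

theorem char_orthogonality (he : e ≠ 1) {ι : Type} [Fintype ι] [DecidableEq ι] (v w : ι → F) :
    ∑ ξ : ι → F, e (ξ ⬝ᵥ v) * (starRingEnd ℂ) (e (ξ ⬝ᵥ w)) =
      if v = w then (((Fintype.card F : ℝ) ^ Fintype.card ι : ℝ) : ℂ) else 0 := by
  simp_rw [← AddChar.map_neg_eq_conj, ← AddChar.map_add_eq_mul, ← sub_eq_add_neg,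
    ← dotProduct_sub]
  rw [sum_char_dotProduct he]
  simp [sub_eq_zero]

theorem char_orthogonality_prod (he : e ≠ 1) {ι : Type} [Fintype ι] [DecidableEq ι]
    (v w : (ι → F) × F) :
    ∑ ξ : (ι → F) × F, e (ξ.1 ⬝ᵥ v.1 + ξ.2 * v.2) *
        (starRingEnd ℂ) (e (ξ.1 ⬝ᵥ w.1 + ξ.2 * w.2)) =
      if v = w then (((Fintype.card F : ℝ) ^ (Fintype.card ι + 1) : ℝ) : ℂ) else 0 := by
  have h (ξ : (ι → F) × F) : e (ξ.1 ⬝ᵥ v.1 + ξ.2 * v.2) *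
      (starRingEnd ℂ) (e (ξ.1 ⬝ᵥ w.1 + ξ.2 * w.2)) =
      e (ξ.1 ⬝ᵥ (v.1 - w.1)) * e (ξ.2 * (v.2 - w.2)) := by
    rw [← AddChar.map_neg_eq_conj, ← AddChar.map_add_eq_mul, ← AddChar.map_add_eq_mul,
      dotProduct_sub]
    ring_nf
  simp_rw [h]
  rw [Fintype.sum_prod_type]
  dsimp only
  rw [← sum_mul_sum, sum_char_dotProduct he, sum_char_mul he]
  simp only [sub_eq_zero, Prod.ext_iff]
  split_ifs <;> simp_all [pow_succ]

/-- The Gauss sum of the quadratic character. -/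
noncomputable def quadGauss (e : AddChar F ℂ) : ℂ :=
  gaussSum ((quadraticChar F).ringHomComp (Int.castRingHom ℂ)) e

theorem norm_quadGauss_sq (hF : ringChar F ≠ 2) (he : e ≠ 1) :
    ‖quadGauss e‖ ^ 2 = Fintype.card F := by
  have hne : (quadraticChar F).ringHomComp (Int.castRingHom ℂ) ≠ 1 :=
    (MulChar.ringHomComp_ne_one_iff (Int.cast_injective)).mpr (quadraticChar_ne_one hF)
  have h := gaussSum_sq hne ((quadraticChar_isQuadratic F).comp _)
    (AddChar.IsPrimitive.of_ne_one he)
  rw [quadGauss, ← norm_pow, h, norm_mul, MulChar.ringHomComp_apply]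
  rcases quadraticChar_dichotomy (F := F) (a := -1) (by simp) with h | h <;> simp [h]

theorem sum_quadraticChar_mul_char (t : F) (hF : ringChar F ≠ 2) :
    ∑ y, (quadraticChar F y : ℂ) * e (t * y) = quadraticChar F t * quadGauss e := by
  by_cases ht : t = 0
  · subst ht
    simp only [zero_mul, AddChar.map_zero_eq_one, mul_one, MulChar.map_zero, Int.cast_zero]
    exact_mod_cast quadraticChar_sum_zero hF
  · have h := gaussSum_mulShift ((quadraticChar F).ringHomComp (Int.castRingHom ℂ)) e
      (Units.mk0 t ht)
    rw [quadGauss, ← h, ← mul_assoc]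
    have h1 : (quadraticChar F t : ℂ) * (quadraticChar F t : ℂ) = 1 := by
      rcases quadraticChar_dichotomy ht with h | h <;> simp [h]
    simp only [MulChar.ringHomComp_apply, gaussSum, AddChar.mulShift_apply, Units.val_mk0,
      eq_intCast]
    rw [h1, one_mul]

theorem sum_char_sq (hF : ringChar F ≠ 2) (he : e ≠ 1) {t : F} (ht : t ≠ 0) :
    ∑ x, e (t * (x * x)) = quadraticChar F t * quadGauss e := by
  rw [← sum_quadraticChar_mul_char t hF, ← sum_fiberwise univ (fun x : F ↦ x * x)]
  have h0 : ∑ y, e (t * y) = 0 := by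
    simp_rw [mul_comm t]; rw [sum_char_mul he, if_neg ht]
  rw [← add_zero (∑ y, (quadraticChar F y : ℂ) * e (t * y)), ← h0, ← sum_add_distrib]
  refine sum_congr rfl fun y _ ↦ ?_
  have h1 := quadraticChar_card_sqrts hF y
  have h2 : ({x | x ^ 2 = y} : Set F).toFinset = ({x | x * x = y} : Finset F) := by
    ext; simp [sq]
  rw [h2] at h1
  rw [sum_congr rfl (g := fun _ ↦ e (t * y)) fun x hx ↦ by rw [(mem_filter.mp hx).2]]
  rw [sum_const, nsmul_eq_mul]
  have h3 : (#({x | x * x = y} : Finset F) : ℂ) = quadraticChar F y + 1 := by exact_mod_cast h1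
  rw [h3]; ring

theorem sum_char_quadratic (hF : ringChar F ≠ 2) (he : e ≠ 1) {t : F} (ht : t ≠ 0) {n : ℕ}
    (v : Fin n → F) :
    ∑ ξ : Fin n → F, e (v ⬝ᵥ ξ + t * (ξ ⬝ᵥ ξ)) =
      (quadraticChar F t * quadGauss e) ^ n * e (-(v ⬝ᵥ v) / (4 * t)) := by
  have h2 : (2 : F) ≠ 0 := Ring.two_ne_zero hF
  have h1 (a : F) : ∑ x, e (a * x + t * (x * x)) =
      quadraticChar F t * quadGauss e * e (-(a * a) / (4 * t)) := by
    rw [← sum_char_sq hF he ht, ← Equiv.sum_comp (Equiv.addRight (a / (2 * t)))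
      fun x ↦ e (t * (x * x)), sum_mul]
    refine sum_congr rfl fun x _ ↦ ?_
    rw [← AddChar.map_add_eq_mul, Equiv.coe_addRight]
    congr 1
    have h4 : (4 : F) = 2 * 2 := by norm_num
    rw [h4]
    field_simp
    ring
  have h3 (ξ : Fin n → F) : e (v ⬝ᵥ ξ + t * (ξ ⬝ᵥ ξ)) = ∏ i, e (v i * ξ i + t * (ξ i * ξ i)) := by
    rw [← char_sum_eq_prod, sum_add_distrib, ← mul_sum]; rfl
  simp_rw [h3]
  rw [← Fintype.piFinset_univ, ← prod_univ_sum (fun _ ↦ univ)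
    fun i x ↦ e (v i * x + t * (x * x))]
  simp_rw [h1]
  rw [prod_mul_distrib, prod_const, ← char_sum_eq_prod, ← sum_div, sum_neg_distrib]
  simp [dotProduct]

end Characters

section Energy

variable {F : Type} [Field F] [Fintype F] [DecidableEq F] {e : AddChar F ℂ}

theorem quadGauss_ne_zero (hF : ringChar F ≠ 2) (he : e ≠ 1) : quadGauss e ≠ 0 := by
  intro h
  have := norm_quadGauss_sq hF he
  rw [h, norm_zero, zero_pow two_ne_zero] at this
  exact Fintype.card_ne_zero (α := F) (by exact_mod_cast this.symm)

/-- In odd dimension the indicator of the isotropic cone has a Fourier transform of size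
square root of its cardinality. -/
theorem cone_kernel (hF : ringChar F ≠ 2) (he : e ≠ 1) {m : ℕ} (v : Fin (2 * m + 1) → F) :
    ((if v ⬝ᵥ v = 0 then (Fintype.card F : ℂ) else 0) - 1) * quadGauss e ^ (2 * m) =
      ∑ ξ : Fin (2 * m + 1) → F, (quadraticChar F (ξ ⬝ᵥ ξ) : ℂ) * e (ξ ⬝ᵥ v) := by
  have h4 : (4 : F) ≠ 0 := by
    have h2 : (2 : F) ≠ 0 := Ring.two_ne_zero hF
    have : (4 : F) = 2 * 2 := by norm_num
    rw [this]; exact mul_ne_zero h2 h2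
  have hinv : ∑ t : F, e (-(v ⬝ᵥ v) / (4 * t)) =
      if v ⬝ᵥ v = 0 then (Fintype.card F : ℂ) else 0 := by
    rw [← sum_char_mul he]
    have hi (t : F) : -(4 * (-(4 * t)⁻¹))⁻¹ = t := by field_simp
    refine Fintype.sum_equiv ⟨fun t ↦ -(4 * t)⁻¹, fun t ↦ -(4 * t)⁻¹, hi, hi⟩ _ _ fun t ↦ ?_
    simp only [Equiv.coe_fn_mk]
    congr 1
    rw [div_eq_mul_inv]; ring
  have hsum : ∑ t ∈ univ.erase (0 : F), e (-(v ⬝ᵥ v) / (4 * t)) =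
      (if v ⬝ᵥ v = 0 then (Fintype.card F : ℂ) else 0) - 1 := by
    rw [← hinv, ← add_sum_erase univ _ (mem_univ (0 : F))]
    simp
  have hg := quadGauss_ne_zero hF he
  refine mul_right_cancel₀ hg ?_
  rw [mul_assoc, ← pow_succ, ← hsum, sum_mul]
  have hterm : ∀ t ∈ univ.erase (0 : F), e (-(v ⬝ᵥ v) / (4 * t)) * quadGauss e ^ (2 * m + 1) =
      ∑ ξ : Fin (2 * m + 1) → F, e (ξ ⬝ᵥ v) * ((quadraticChar F t : ℂ) * e ((ξ ⬝ᵥ ξ) * t)) := by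
    intro t ht
    have ht0 := ne_of_mem_erase ht
    have h1 : (quadraticChar F t : ℂ) * (quadraticChar F t : ℂ) ^ (2 * m + 1) = 1 := by
      rcases quadraticChar_dichotomy ht0 with h | h <;> simp [h, pow_succ, pow_mul]
    calc _ = (quadraticChar F t : ℂ) *
          ((quadraticChar F t * quadGauss e) ^ (2 * m + 1) * e (-(v ⬝ᵥ v) / (4 * t))) := by
          rw [mul_pow]; linear_combination (-e (-(v ⬝ᵥ v) / (4 * t)) *
            quadGauss e ^ (2 * m + 1)) * h1
      _ = _ := by
          rw [← sum_char_quadratic hF he ht0, mul_sum]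
          refine sum_congr rfl fun ξ _ ↦ ?_
          rw [AddChar.map_add_eq_mul, dotProduct_comm, mul_comm t]
          ring
  rw [sum_congr rfl hterm, sum_comm, sum_mul]
  refine sum_congr rfl fun ξ _ ↦ ?_
  rw [← mul_sum, mul_right_comm, ← sum_quadraticChar_mul_char _ hF, mul_comm,
    sum_erase _ (by simp)]

theorem card_pairs_cone_le (hF : ringChar F ≠ 2) (he : e ≠ 1) {m : ℕ}
    (A : Finset (Fin (2 * m + 1) → F)) :
    (#{p ∈ A ×ˢ A | (p.1 - p.2) ⬝ᵥ (p.1 - p.2) = 0} : ℝ) ≤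
      (#A : ℝ) ^ 2 / Fintype.card F + (Fintype.card F : ℝ) ^ m * #A := by
  have hq : (0 : ℝ) < Fintype.card F := by exact_mod_cast Fintype.card_pos
  set N := #{p ∈ A ×ˢ A | (p.1 - p.2) ⬝ᵥ (p.1 - p.2) = 0} with hN
  have h1 : ((Fintype.card F : ℂ) * N - (#A : ℂ) ^ 2) * quadGauss e ^ (2 * m) =
      ∑ ξ : Fin (2 * m + 1) → F, (quadraticChar F (ξ ⬝ᵥ ξ) : ℂ) *
        ((‖∑ a ∈ A, 1 * e (ξ ⬝ᵥ a)‖ ^ 2 : ℝ) : ℂ) := by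
    have h2 : (Fintype.card F : ℂ) * N - (#A : ℂ) ^ 2 = ∑ p ∈ A ×ˢ A,
        ((if (p.1 - p.2) ⬝ᵥ (p.1 - p.2) = 0 then (Fintype.card F : ℂ) else 0) - 1) := by
      rw [sum_sub_distrib, ← sum_filter, sum_const, sum_const, card_product, nsmul_eq_mul,
        nsmul_eq_mul]
      push_cast
      ring
    rw [h2, sum_mul]
    simp_rw [cone_kernel hF he]
    rw [sum_comm]
    refine sum_congr rfl fun ξ _ ↦ ?_
    rw [← mul_sum]
    congr 1
    push_cast
    rw [← Complex.mul_conj', map_sum, sum_mul_sum, sum_product]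
    simp_rw [dotProduct_sub, one_mul, ← AddChar.map_neg_eq_conj, ← AddChar.map_add_eq_mul,
      sub_eq_add_neg]
  have h3 := sum_norm_sq_univ (fun ξ v : Fin (2 * m + 1) → F ↦ e (ξ ⬝ᵥ v)) _
    (char_orthogonality he) A fun _ ↦ 1
  have h4 : ‖((Fintype.card F : ℂ) * N - (#A : ℂ) ^ 2) * quadGauss e ^ (2 * m)‖ ≤
      (Fintype.card F : ℝ) ^ (2 * m + 1) * #A := by
    rw [h1]
    simp only [norm_one, one_pow, sum_const, nsmul_eq_mul, mul_one, Fintype.card_fin] at h3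
    rw [← h3]
    refine (norm_sum_le _ _).trans (sum_le_sum fun ξ _ ↦ ?_)
    rw [norm_mul, Complex.norm_real, Real.norm_of_nonneg (by positivity)]
    refine mul_le_of_le_one_left (by positivity) ?_
    rcases eq_or_ne (ξ ⬝ᵥ ξ) 0 with h | h
    · simp [h]
    · rcases quadraticChar_dichotomy h with h | h <;> simp [h]
  rw [norm_mul, norm_pow, pow_mul, norm_quadGauss_sq hF he] at h4
  have h5 : (Fintype.card F : ℝ) * N - (#A : ℝ) ^ 2 ≤
      ‖(Fintype.card F : ℂ) * N - (#A : ℂ) ^ 2‖ := by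
    have : (Fintype.card F : ℂ) * N - (#A : ℂ) ^ 2 =
      (((Fintype.card F : ℝ) * N - (#A : ℝ) ^ 2 : ℝ) : ℂ) := by push_cast; rfl
    rw [this, Complex.norm_real]
    exact le_abs_self _
  have h6 : ‖(Fintype.card F : ℂ) * N - (#A : ℂ) ^ 2‖ ≤ (Fintype.card F : ℝ) ^ (m + 1) * #A := by
    refine le_of_mul_le_mul_right (h4.trans_eq ?_) (pow_pos hq m)
    ring
  rw [div_add' _ _ _ hq.ne', le_div_iff₀ hq]
  linear_combination h5 + h6

theorem sum_char_dotProduct_fin (he : e ≠ 1) {n : ℕ} (v : Fin n → F) :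
    ∑ ξ : Fin n → F, e (ξ ⬝ᵥ v) = if v = 0 then (Fintype.card F : ℂ) ^ n else 0 := by
  rw [sum_char_dotProduct he, Fintype.card_fin]

theorem card_hyperplane (he : e ≠ 1) {k : ℕ} (c : Fin (k + 1) → F) {v : Fin (k + 1) → F}
    (hv : v ≠ 0) :
    #{a | (a - c) ⬝ᵥ v = 0} = Fintype.card F ^ k := by
  have hq : (Fintype.card F : ℂ) ≠ 0 := by exact_mod_cast Fintype.card_ne_zero
  have h : (Fintype.card F : ℂ) * #{a | (a - c) ⬝ᵥ v = 0} = (Fintype.card F : ℂ) ^ (k + 1) := by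
    calc _ = ∑ a : Fin (k + 1) → F, ∑ s : F, e (s * ((a - c) ⬝ᵥ v)) := by
          simp_rw [sum_char_mul he]
          rw [← sum_filter, sum_const, nsmul_eq_mul, mul_comm]
      _ = ∑ s : F, (∑ a : Fin (k + 1) → F, e (a ⬝ᵥ (s • v))) * e (-(s * (c ⬝ᵥ v))) := by
          rw [sum_comm]
          simp_rw [sum_mul, ← AddChar.map_add_eq_mul, dotProduct_smul, sub_dotProduct, mul_sub,
            smul_eq_mul, sub_eq_add_neg]
      _ = _ := by
          simp_rw [sum_char_dotProduct_fin he, smul_eq_zero, hv, or_false, ite_mul, zero_mul]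
          rw [sum_ite_eq' univ (0 : F)]
          simp
  rw [pow_succ'] at h
  exact_mod_cast mul_left_cancel₀ hq h

theorem card_inter_hyperplanes_le (he : e ≠ 1) {k : ℕ} (c c' : Fin (k + 1) → F)
    {v v' : Fin (k + 1) → F} (hv : v ≠ 0) (hv' : v' ≠ 0) :
    (#{a | (a - c) ⬝ᵥ v = 0 ∧ (a - c') ⬝ᵥ v' = 0} : ℝ) * (Fintype.card F : ℝ) ^ 2 ≤
      (Fintype.card F : ℝ) ^ (k + 1) +
        if ∃ t : F, v' = t • v ∧ (c' - c) ⬝ᵥ v = 0 then (Fintype.card F : ℝ) ^ (k + 2) else 0 := by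
  classical
  by_cases hpar : ∃ t : F, v' = t • v
  · obtain ⟨t, rfl⟩ := hpar
    have ht : t ≠ 0 := by rintro rfl; simp at hv'
    by_cases hc : (c' - c) ⬝ᵥ v = 0
    · rw [if_pos ⟨t, rfl, hc⟩]
      have h1 : #{a | (a - c) ⬝ᵥ v = 0 ∧ (a - c') ⬝ᵥ (t • v) = 0} ≤ Fintype.card F ^ k := by
        rw [← card_hyperplane he c hv]
        exact card_le_card fun a ↦ by simp +contextual
      have h2 : (#{a | (a - c) ⬝ᵥ v = 0 ∧ (a - c') ⬝ᵥ (t • v) = 0} : ℝ) ≤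
        (Fintype.card F : ℝ) ^ k := by exact_mod_cast h1
      calc _ ≤ (Fintype.card F : ℝ) ^ k * (Fintype.card F : ℝ) ^ 2 := by gcongr
        _ = (Fintype.card F : ℝ) ^ (k + 2) := by ring
        _ ≤ _ := le_add_of_nonneg_left (by positivity)
    · have h1 : ({a | (a - c) ⬝ᵥ v = 0 ∧ (a - c') ⬝ᵥ (t • v) = 0} : Finset _) = ∅ := by
        refine filter_eq_empty_iff.mpr fun a _ ⟨ha, ha'⟩ ↦ hc ?_
        rw [dotProduct_smul, smul_eq_mul, mul_eq_zero, or_iff_right ht] at ha'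
        rw [← sub_eq_zero.mpr (ha.trans ha'.symm), ← sub_dotProduct]
        congr 1; abel
      rw [h1]
      simp only [card_empty, Nat.cast_zero, zero_mul]
      positivity
  · refine le_add_of_le_of_nonneg (le_of_eq ?_) (by positivity)
    have hind (s s' : F) (h : s • v + s' • v' = 0) : s = 0 ∧ s' = 0 := by
      have hs' : s' = 0 := by
        by_contra hs'
        refine hpar ⟨-(s'⁻¹ * s), ?_⟩
        rw [neg_smul, mul_smul, eq_neg_of_add_eq_zero_left h, smul_neg, neg_neg, smul_smul,
          inv_mul_cancel₀ hs', one_smul]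
      subst hs'
      simpa [hv] using h
    have h : (#{a | (a - c) ⬝ᵥ v = 0 ∧ (a - c') ⬝ᵥ v' = 0} : ℂ) * (Fintype.card F : ℂ) ^ 2 =
        (Fintype.card F : ℂ) ^ (k + 1) := by
      calc _ = ∑ a : Fin (k + 1) → F,
            (∑ s : F, e (s * ((a - c) ⬝ᵥ v))) * ∑ s : F, e (s * ((a - c') ⬝ᵥ v')) := by
            simp_rw [sum_char_mul he, ite_zero_mul_ite_zero]
            rw [← sum_filter, sum_const, nsmul_eq_mul, sq]
        _ = ∑ s : F, ∑ s' : F, (∑ a : Fin (k + 1) → F, e (a ⬝ᵥ (s • v + s' • v'))) *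
            e (-(s * (c ⬝ᵥ v)) - s' * (c' ⬝ᵥ v')) := by
            simp_rw [sum_mul_sum]
            rw [sum_comm]
            refine sum_congr rfl fun s _ ↦ ?_
            rw [sum_comm]
            refine sum_congr rfl fun s' _ ↦ ?_
            rw [sum_mul]
            refine sum_congr rfl fun a _ ↦ ?_
            rw [← AddChar.map_add_eq_mul, ← AddChar.map_add_eq_mul]
            congr 1
            simp only [dotProduct_add, dotProduct_smul, sub_dotProduct, smul_eq_mul]
            ring
        _ = _ := by
            simp_rw [sum_char_dotProduct_fin he]
            rw [sum_eq_single 0, sum_eq_single 0]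
            · simp
            · intro s' _ hs'
              rw [if_neg fun h ↦ hs' (hind _ _ h).2, zero_mul]
            · simp
            · intro s _ hs
              exact sum_eq_zero fun s' _ ↦ by rw [if_neg fun h ↦ hs (hind _ _ h).1, zero_mul]
            · simp
    exact_mod_cast h

end Energy

section Incidence

variable {F : Type} [Field F] [Fintype F] [DecidableEq F] {e : AddChar F ℂ}

open Classical in
/-- Point-hyperplane incidence bound, for a family of hyperplanes given by a base point and a
normal vector. -/
theorem incidence_sq_le (he : e ≠ 1) {k : ℕ} {J : Type*} (s : Finset J)
    (c v : J → Fin (k + 1) → F) (hv : ∀ j ∈ s, v j ≠ 0) (E : Finset (Fin (k + 1) → F)) :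
    ((∑ a ∈ E, (#{j ∈ s | (a - c j) ⬝ᵥ v j = 0} : ℝ)) - #E * #s / Fintype.card F) ^ 2 ≤
      #E * (Fintype.card F : ℝ) ^ k *
        #{p ∈ s ×ˢ s | ∃ t : F, v p.2 = t • v p.1 ∧ (c p.2 - c p.1) ⬝ᵥ v p.1 = 0} := by
  have hq : (0 : ℝ) < Fintype.card F := by exact_mod_cast Fintype.card_pos
  set q := (Fintype.card F : ℝ) with hqdef
  set R := #{p ∈ s ×ˢ s | ∃ t : F, v p.2 = t • v p.1 ∧ (c p.2 - c p.1) ⬝ᵥ v p.1 = 0} with hR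
  set Y : (Fin (k + 1) → F) → ℝ := fun a ↦ #{j ∈ s | (a - c j) ⬝ᵥ v j = 0} with hY
  have hY' (a) : Y a = ∑ j ∈ s, if (a - c j) ⬝ᵥ v j = 0 then (1 : ℝ) else 0 := by
    simp [hY]
  have h1 : ∑ a, Y a = #s * q ^ k := by
    simp_rw [hY']
    rw [sum_comm, sum_congr rfl (g := fun _ ↦ q ^ k), sum_const, nsmul_eq_mul]
    intro j hj
    rw [← sum_filter, sum_const, card_hyperplane he _ (hv j hj)]
    simp [hqdef]
  have h2 : (∑ a, Y a ^ 2) * q ^ 2 ≤ #s ^ 2 * q ^ (k + 1) + q ^ (k + 2) * R := by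
    calc (∑ a, Y a ^ 2) * q ^ 2 = ∑ i ∈ s, ∑ j ∈ s,
          (#{a | (a - c i) ⬝ᵥ v i = 0 ∧ (a - c j) ⬝ᵥ v j = 0} : ℝ) * q ^ 2 := by
          simp_rw [hY', sq (∑ j ∈ s, _), sum_mul_sum, ite_zero_mul_ite_zero, ← sum_mul]
          congr 1
          rw [sum_comm]
          refine sum_congr rfl fun i _ ↦ ?_
          rw [sum_comm]
          refine sum_congr rfl fun j _ ↦ ?_
          simp
      _ ≤ ∑ i ∈ s, ∑ j ∈ s, (q ^ (k + 1) +
          if ∃ t : F, v j = t • v i ∧ (c j - c i) ⬝ᵥ v i = 0 then q ^ (k + 2) else 0) :=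
          sum_le_sum fun i hi ↦ sum_le_sum fun j hj ↦
            card_inter_hyperplanes_le he (c i) (c j) (hv i hi) (hv j hj)
      _ = _ := by
          rw [← sum_product', sum_add_distrib, ← sum_filter, sum_const, sum_const, card_product]
          simp only [nsmul_eq_mul, hR]
          push_cast
          ring
  have h3 : ∑ a, (Y a - #s / q) ^ 2 ≤ q ^ k * R := by
    refine le_of_mul_le_mul_right ?_ (pow_pos hq 2)
    have : ∑ a, (Y a - #s / q) ^ 2 =
        ∑ a, Y a ^ 2 - 2 * (#s / q) * ∑ a, Y a + q ^ (k + 1) * (#s / q) ^ 2 := by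
      simp_rw [sub_sq, sum_add_distrib, sum_sub_distrib, mul_sum, sum_const, card_univ,
        Fintype.card_fun, Fintype.card_fin, nsmul_eq_mul]
      push_cast
      congr 2
      exact sum_congr rfl fun a _ ↦ by ring
    rw [this, h1]
    have h4 : (∑ a, Y a ^ 2 - 2 * (#s / q) * (#s * q ^ k) + q ^ (k + 1) * (#s / q) ^ 2) * q ^ 2 =
        (∑ a, Y a ^ 2) * q ^ 2 - #s ^ 2 * q ^ (k + 1) := by
      field_simp
      ring
    rw [h4]
    linear_combination h2
  have h5 : (∑ a ∈ E, Y a) - #E * #s / q = ∑ a ∈ E, (Y a - #s / q) := by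
    rw [sum_sub_distrib, sum_const, nsmul_eq_mul, mul_div_assoc]
  rw [h5]
  calc _ ≤ #E * ∑ a ∈ E, (Y a - #s / q) ^ 2 := sq_sum_le_card_mul_sum_sq
    _ ≤ #E * ∑ a, (Y a - #s / q) ^ 2 := by
        gcongr
        exact subset_univ _
    _ ≤ _ := by rw [mul_assoc]; gcongr

/-- Right angles in `E` one of whose legs is anisotropic. -/
theorem card_anisotropic_corners_le (he : e ≠ 1) {m : ℕ} (E : Finset (Fin (2 * m + 1) → F)) :
    (#{p ∈ E ×ˢ (E ×ˢ E) | (p.1 - p.2.2) ⬝ᵥ (p.2.1 - p.2.2) = 0 ∧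
        (p.2.1 - p.2.2) ⬝ᵥ (p.2.1 - p.2.2) ≠ 0} : ℝ) ≤
      (#E : ℝ) ^ 3 / Fintype.card F + (Fintype.card F : ℝ) ^ m * #E ^ 2 := by
  classical
  have hq : (0 : ℝ) < Fintype.card F := by exact_mod_cast Fintype.card_pos
  set s := {p ∈ E ×ˢ E | (p.1 - p.2) ⬝ᵥ (p.1 - p.2) ≠ 0} with hs
  have hinc := incidence_sq_le he s (fun p ↦ p.2) (fun p ↦ p.1 - p.2)
    (fun p hp h ↦ (mem_filter.mp hp).2 (by simp [h])) E
  set R := #{p ∈ s ×ˢ s | ∃ t : F, p.2.1 - p.2.2 = t • (p.1.1 - p.1.2) ∧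
    (p.2.2 - p.1.2) ⬝ᵥ (p.1.1 - p.1.2) = 0} with hR
  have hRle : R ≤ #E ^ 3 := by
    have hc : #(E ×ˢ E ×ˢ E) = #E ^ 3 := by rw [card_product, card_product]; ring
    rw [← hc, hR]
    refine card_le_card_of_injOn (fun p ↦ (p.1.1, p.1.2, p.2.1)) ?_ ?_
    · intro p hp
      simp only [coe_filter, mem_product, hs, mem_filter, Set.mem_ofPred_eq] at hp
      simp only [coe_product, Set.mem_prod, mem_coe]
      tauto
    · rintro ⟨⟨b, c⟩, b', c'⟩ hp ⟨⟨b₁, c₁⟩, b₁', c₁'⟩ hp₁ heq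
      simp only [Prod.mk.injEq] at heq
      obtain ⟨rfl, rfl, rfl⟩ := heq
      simp only [coe_filter, mem_product, hs, mem_filter, Set.mem_ofPred_eq] at hp hp₁
      obtain ⟨⟨⟨-, hne⟩, -⟩, t, ht, ho⟩ := hp
      obtain ⟨-, t₁, ht₁, ho₁⟩ := hp₁
      have h1 : (t - t₁) • (b - c) = c₁' - c' := by
        rw [sub_smul, ← ht, ← ht₁]; abel
      have h2 : (t - t₁) * ((b - c) ⬝ᵥ (b - c)) = 0 := by
        rw [← smul_eq_mul, ← smul_dotProduct, h1]
        have : c₁' - c' = (c₁' - c) - (c' - c) := by abel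
        rw [this, sub_dotProduct, ho, ho₁, sub_zero]
      have h3 := (mul_eq_zero.mp h2).resolve_right hne
      rw [h3, zero_smul, eq_comm, sub_eq_zero] at h1
      rw [h1]
  have hsle : #s ≤ #E ^ 2 := (card_filter_le _ _).trans_eq (by rw [card_product, sq])
  have hN : (#{p ∈ E ×ˢ (E ×ˢ E) | (p.1 - p.2.2) ⬝ᵥ (p.2.1 - p.2.2) = 0 ∧
        (p.2.1 - p.2.2) ⬝ᵥ (p.2.1 - p.2.2) ≠ 0} : ℝ) =
      ∑ a ∈ E, (#{j ∈ s | (a - j.2) ⬝ᵥ (j.1 - j.2) = 0} : ℝ) := by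
    simp_rw [card_filter, Nat.cast_sum]
    rw [sum_product]
    refine sum_congr rfl fun a _ ↦ ?_
    rw [hs, sum_filter]
    refine sum_congr rfl fun p _ ↦ ?_
    split_ifs <;> simp_all
  rw [hN]
  have h1 := Real.le_sqrt_of_sq_le hinc
  have h2 : √(#E * (Fintype.card F : ℝ) ^ (2 * m) * R) ≤ (Fintype.card F : ℝ) ^ m * #E ^ 2 := by
    refine Real.sqrt_le_iff.mpr ⟨by positivity, ?_⟩
    calc _ ≤ #E * (Fintype.card F : ℝ) ^ (2 * m) * (#E ^ 3 : ℕ) := by gcongr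
      _ = _ := by push_cast; ring
  have h3 : (#E : ℝ) * #s / Fintype.card F ≤ (#E : ℝ) ^ 3 / Fintype.card F := by
    gcongr
    calc (#E : ℝ) * #s ≤ #E * (#E ^ 2 : ℕ) := by gcongr
      _ = _ := by push_cast; ring
  linarith

/-- Right angles in `E` with isotropic legs: these are triangles in the isotropic cone graph. -/
theorem card_isotropic_corners_le (hF : ringChar F ≠ 2) (he : e ≠ 1) {m : ℕ}
    (E : Finset (Fin (2 * m + 1) → F)) :
    (#{p ∈ E ×ˢ (E ×ˢ E) | (p.1 - p.2.2) ⬝ᵥ (p.2.1 - p.2.2) = 0 ∧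
        (p.1 - p.2.2) ⬝ᵥ (p.1 - p.2.2) = 0 ∧ (p.2.1 - p.2.2) ⬝ᵥ (p.2.1 - p.2.2) = 0} : ℝ) ≤
      (#E : ℝ) ^ 3 / Fintype.card F + (Fintype.card F : ℝ) ^ m * #E ^ 2 := by
  have hq : (0 : ℝ) < Fintype.card F := by exact_mod_cast Fintype.card_pos
  set S := fun c ↦ {a ∈ E | (a - c) ⬝ᵥ (a - c) = 0} with hS
  have hN : #{p ∈ E ×ˢ (E ×ˢ E) | (p.1 - p.2.2) ⬝ᵥ (p.2.1 - p.2.2) = 0 ∧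
        (p.1 - p.2.2) ⬝ᵥ (p.1 - p.2.2) = 0 ∧ (p.2.1 - p.2.2) ⬝ᵥ (p.2.1 - p.2.2) = 0} ≤
      ∑ c ∈ E, #{p ∈ S c ×ˢ S c | (p.1 - p.2) ⬝ᵥ (p.1 - p.2) = 0} := by
    rw [← card_sigma]
    refine card_le_card_of_injOn (fun p ↦ ⟨p.2.2, p.1, p.2.1⟩) ?_ ?_
    · rintro ⟨a, b, c⟩ hp
      simp only [coe_filter, mem_product, Set.mem_ofPred_eq] at hp
      obtain ⟨⟨ha, hb, hc⟩, hab, haa, hbb⟩ := hp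
      simp only [coe_sigma, Set.mem_sigma_iff, mem_coe, mem_filter, mem_product, hS]
      refine ⟨hc, ⟨⟨ha, haa⟩, hb, hbb⟩, ?_⟩
      have : a - b = (a - c) - (b - c) := by abel
      rw [this, sub_dotProduct, dotProduct_sub (a - c) (a - c), dotProduct_sub (b - c) (a - c),
        dotProduct_comm (b - c) (a - c), hab, haa, hbb]
      simp
    · rintro ⟨a, b, c⟩ - ⟨a', b', c'⟩ - h
      simp only [Sigma.mk.injEq, heq_eq_eq, Prod.mk.injEq] at h
      obtain ⟨rfl, rfl, rfl⟩ := h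
      rfl
  have hSle (c) : (#(S c) : ℝ) ≤ #E := by exact_mod_cast card_filter_le _ _
  calc _ ≤ ∑ c ∈ E, (#{p ∈ S c ×ˢ S c | (p.1 - p.2) ⬝ᵥ (p.1 - p.2) = 0} : ℝ) := by
        exact_mod_cast hN
    _ ≤ ∑ c ∈ E, ((#E : ℝ) ^ 2 / Fintype.card F + (Fintype.card F : ℝ) ^ m * #E) := by
        refine sum_le_sum fun c _ ↦ (card_pairs_cone_le hF he (S c)).trans ?_
        have := hSle c
        gcongr
    _ = _ := by rw [sum_const, nsmul_eq_mul]; ring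

/-- Additive energy of the lift of `E` to the paraboloid. -/
def energy {n : ℕ} (E : Finset (Fin n → F)) : ℕ :=
  #{p ∈ (E ×ˢ E) ×ˢ (E ×ˢ E) | p.1.1 + p.1.2 = p.2.1 + p.2.2 ∧
    p.1.1 ⬝ᵥ p.1.1 + p.1.2 ⬝ᵥ p.1.2 = p.2.1 ⬝ᵥ p.2.1 + p.2.2 ⬝ᵥ p.2.2}

theorem energy_le_card_corners {F : Type} [Field F] [DecidableEq F] (hF : ringChar F ≠ 2)
    {n : ℕ} (E : Finset (Fin n → F)) :
    energy E ≤ #{p ∈ E ×ˢ (E ×ˢ E) | (p.1 - p.2.2) ⬝ᵥ (p.2.1 - p.2.2) = 0} := by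
  refine card_le_card_of_injOn (fun p ↦ (p.1.1, p.1.2, p.2.1)) ?_ ?_
  · rintro ⟨⟨a, b⟩, c, d⟩ hp
    simp only [coe_filter, mem_product, Set.mem_ofPred_eq] at hp
    obtain ⟨⟨⟨ha, hb⟩, hc, -⟩, h1, h2⟩ := hp
    simp only [coe_filter, mem_product, Set.mem_ofPred_eq]
    refine ⟨⟨ha, hb, hc⟩, ?_⟩
    have hd : d = a + b - c := by rw [h1]; abel
    subst hd
    refine (mul_eq_zero.mp (?_ : (2 : F) * _ = 0)).resolve_left (Ring.two_ne_zero hF)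
    simp only [sub_dotProduct, dotProduct_sub, add_dotProduct, dotProduct_add] at h2 ⊢
    rw [dotProduct_comm b a, dotProduct_comm c a, dotProduct_comm c b] at h2
    rw [dotProduct_comm c b]
    linear_combination -h2
  · rintro ⟨⟨a, b⟩, c, d⟩ hp ⟨⟨a', b'⟩, c', d'⟩ hp' h
    simp only [Prod.mk.injEq] at h
    obtain ⟨rfl, rfl, rfl⟩ := h
    simp only [coe_filter, Set.mem_ofPred_eq] at hp hp'
    rw [add_left_cancel (hp.2.1.symm.trans hp'.2.1)]

theorem energy_le (hF : ringChar F ≠ 2) (he : e ≠ 1) {m : ℕ} (E : Finset (Fin (2 * m + 1) → F)) :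
    (energy E : ℝ) ≤
      3 * ((#E : ℝ) ^ 3 / Fintype.card F + (Fintype.card F : ℝ) ^ m * #E ^ 2) := by
  set T := E ×ˢ (E ×ˢ E)
  set T₁ := {p ∈ T | (p.1 - p.2.2) ⬝ᵥ (p.2.1 - p.2.2) = 0 ∧
    (p.2.1 - p.2.2) ⬝ᵥ (p.2.1 - p.2.2) ≠ 0} with hT₁
  set T₂ := {p ∈ T | (p.1 - p.2.2) ⬝ᵥ (p.2.1 - p.2.2) = 0 ∧
    (p.1 - p.2.2) ⬝ᵥ (p.1 - p.2.2) ≠ 0} with hT₂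
  set T₃ := {p ∈ T | (p.1 - p.2.2) ⬝ᵥ (p.2.1 - p.2.2) = 0 ∧
    (p.1 - p.2.2) ⬝ᵥ (p.1 - p.2.2) = 0 ∧ (p.2.1 - p.2.2) ⬝ᵥ (p.2.1 - p.2.2) = 0} with hT₃
  have hsub : {p ∈ T | (p.1 - p.2.2) ⬝ᵥ (p.2.1 - p.2.2) = 0} ⊆ T₁ ∪ T₂ ∪ T₃ := by
    intro p hp
    simp only [mem_filter, mem_union, hT₁, hT₂, hT₃] at hp ⊢
    tauto
  have h12 : #T₂ ≤ #T₁ := by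
    refine card_le_card_of_injOn (fun p ↦ (p.2.1, p.1, p.2.2)) ?_ ?_
    · rintro ⟨a, b, c⟩ hp
      simp only [hT₂, hT₁, T, coe_filter, mem_product, Set.mem_ofPred_eq] at hp ⊢
      rw [dotProduct_comm]
      tauto
    · rintro ⟨a, b, c⟩ - ⟨a', b', c'⟩ - h
      simp only [Prod.mk.injEq] at h ⊢
      tauto
  have hle : energy E ≤ #T₁ + #T₁ + #T₃ :=
    calc _ ≤ _ := energy_le_card_corners hF E
      _ ≤ _ := card_le_card hsub
      _ ≤ _ := card_union_le _ _
      _ ≤ #T₁ + #T₂ + #T₃ := by gcongr; exact card_union_le _ _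
      _ ≤ _ := by gcongr
  have h1 := card_anisotropic_corners_le he E
  have h3 := card_isotropic_corners_le hF he E
  have hle' : (energy E : ℝ) ≤ #T₁ + #T₁ + #T₃ := by exact_mod_cast hle
  linarith

end Incidence

section Kernel

variable {F : Type} [Field F] [Fintype F] [DecidableEq F] {e : AddChar F ℂ}

theorem sum_norm_pow_four_le (he : e ≠ 1) {n : ℕ} (A : Finset (Fin n → F)) (w : (Fin n → F) → ℂ)
    (hw : ∀ y, ‖w y‖ ≤ 1) :
    ∑ ξ : (Fin n → F) × F, ‖∑ y ∈ A, w y * e (ξ.1 ⬝ᵥ y + ξ.2 * (y ⬝ᵥ y))‖ ^ 4 ≤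
      (Fintype.card F : ℝ) ^ (n + 1) * energy A := by
  have h := sum_norm_sq_le (fun ξ v : (Fin n → F) × F ↦ e (ξ.1 ⬝ᵥ v.1 + ξ.2 * v.2))
    (by positivity) (char_orthogonality_prod he) (A ×ˢ A) (fun p ↦ w p.1 * w p.2)
    (fun p _ ↦ by
      rw [norm_mul]; exact mul_le_one₀ (hw _) (norm_nonneg _) (hw _))
    (fun p ↦ (p.1 + p.2, p.1 ⬝ᵥ p.1 + p.2 ⬝ᵥ p.2))
  rw [Fintype.card_fin] at h
  refine (le_of_eq ?_).trans (h.trans_eq ?_)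
  · refine sum_congr rfl fun ξ _ ↦ ?_
    rw [show 4 = 2 * 2 by norm_num, pow_mul, ← norm_pow, sq (∑ y ∈ A, _), sum_mul_sum, sum_product]
    congr 2
    refine sum_congr rfl fun a _ ↦ sum_congr rfl fun b _ ↦ ?_
    rw [mul_mul_mul_comm, ← AddChar.map_add_eq_mul, dotProduct_add]
    congr 2
    ring
  · simp only [Prod.mk.injEq]
    rfl

/-- The Fourier transform of the normalized surface measure on the paraboloid. -/
noncomputable def surfaceKernel {n : ℕ} (e : AddChar F ℂ) (x : (Fin n → F) × F) : ℂ :=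
  ((Fintype.card F : ℂ) ^ n)⁻¹ * ∑ y : Fin n → F, e (x.1 ⬝ᵥ y + x.2 * (y ⬝ᵥ y))

theorem surfaceKernel_of_snd_eq_zero (he : e ≠ 1) {n : ℕ} (x : Fin n → F) :
    surfaceKernel e (x, 0) = if x = 0 then 1 else 0 := by
  have hq : (Fintype.card F : ℂ) ≠ 0 := by exact_mod_cast Fintype.card_ne_zero
  simp_rw [surfaceKernel, zero_mul, add_zero, dotProduct_comm x]
  rw [sum_char_dotProduct_fin he]
  split_ifs
  · exact inv_mul_cancel₀ (pow_ne_zero _ hq)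
  · simp

theorem surfaceKernel_sub (hF : ringChar F ≠ 2) (he : e ≠ 1) {n : ℕ} (x y : Fin n → F) {t : F}
    (ht : t ≠ 0) :
    surfaceKernel e (x - y, t) =
      ((Fintype.card F : ℂ) ^ n)⁻¹ * (quadraticChar F t * quadGauss e) ^ n *
        e (-(x ⬝ᵥ x) / (4 * t)) *
        e (((2 * t)⁻¹ • x) ⬝ᵥ y + -(4 * t)⁻¹ * (y ⬝ᵥ y)) := by
  have h2 : (2 : F) ≠ 0 := Ring.two_ne_zero hF
  have h4 : (4 : F) = 2 * 2 := by norm_num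
  rw [surfaceKernel, sum_char_quadratic hF he ht, ← mul_assoc, mul_assoc _ (e _) (e _),
    ← AddChar.map_add_eq_mul]
  congr 2
  rw [sub_dotProduct, dotProduct_sub, dotProduct_sub, smul_dotProduct, dotProduct_comm y x,
    smul_eq_mul, h4]
  field_simp
  ring

theorem norm_kernel_coeff (hF : ringChar F ≠ 2) (he : e ≠ 1) (n : ℕ) {t : F} (ht : t ≠ 0) :
    ‖((Fintype.card F : ℂ) ^ n)⁻¹ * (quadraticChar F t * quadGauss e) ^ n‖ ^ 4 =
      ((Fintype.card F : ℝ) ^ (2 * n))⁻¹ := by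
  have hq : (Fintype.card F : ℝ) ≠ 0 := by exact_mod_cast Fintype.card_ne_zero
  have hχ : ‖(quadraticChar F t : ℂ)‖ = 1 := by
    rcases quadraticChar_dichotomy ht with h | h <;> simp [h]
  rw [norm_mul, norm_inv, norm_pow, norm_pow, norm_mul, hχ, one_mul, Complex.norm_natCast]
  calc _ = (((Fintype.card F : ℝ) ^ n)⁻¹) ^ 4 * (‖quadGauss e‖ ^ 2) ^ (2 * n) := by ring
    _ = _ := by
      rw [norm_quadGauss_sq hF he]
      field_simp
      ring

/-- `L⁴` bound for the kernel applied to a function living on a horizontal slice. -/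
theorem slice_pow_four_le (hF : ringChar F ≠ 2) (he : e ≠ 1) {n : ℕ}
    (E : Finset ((Fin n → F) × F)) (A : Finset (Fin n → F)) (w : (Fin n → F) → ℂ)
    (hw : ∀ y, ‖w y‖ ≤ 1) (z : F) :
    (∑ x ∈ E with x.2 ≠ z, ‖∑ y ∈ A, w y * surfaceKernel e (x.1 - y, x.2 - z)‖) ^ 4 ≤
      (#E : ℝ) ^ 3 * (((Fintype.card F : ℝ) ^ (2 * n))⁻¹ *
        ((Fintype.card F : ℝ) ^ (n + 1) * energy A)) := by
  have h2 : (2 : F) ≠ 0 := Ring.two_ne_zero hF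
  have h4 : (4 : F) ≠ 0 := by
    have : (4 : F) = 2 * 2 := by norm_num
    rw [this]; exact mul_ne_zero h2 h2
  set E' := E.filter fun x ↦ x.2 ≠ z with hE'
  set Φ : (Fin n → F) × F → (Fin n → F) × F :=
    fun x ↦ ((2 * (x.2 - z))⁻¹ • x.1, -(4 * (x.2 - z))⁻¹) with hΦ
  set H : (Fin n → F) × F → ℝ := fun ξ ↦ ‖∑ y ∈ A, w y * e (ξ.1 ⬝ᵥ y + ξ.2 * (y ⬝ᵥ y))‖ with hH
  have hne : ∀ x ∈ E', x.2 - z ≠ 0 := fun x hx ↦ sub_ne_zero.mpr (mem_filter.mp hx).2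
  have hinj : Set.InjOn Φ E' := by
    intro x hx y hy hxy
    have hx0 := hne x hx
    simp only [hΦ, Prod.mk.injEq, neg_inj, inv_inj] at hxy
    have h1 : x.2 - z = y.2 - z := mul_left_cancel₀ h4 hxy.2
    refine Prod.ext ?_ (sub_left_injective h1)
    have h3 := hxy.1
    rw [← h1] at h3
    exact smul_right_injective _ (inv_ne_zero (mul_ne_zero h2 hx0)) h3
  have hterm : ∀ x ∈ E', ‖∑ y ∈ A, w y * surfaceKernel e (x.1 - y, x.2 - z)‖ ^ 4 =
      ((Fintype.card F : ℝ) ^ (2 * n))⁻¹ * H (Φ x) ^ 4 := by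
    intro x hx
    rw [← norm_kernel_coeff hF he n (hne x hx), ← mul_pow, hH, ← norm_mul]
    simp_rw [surfaceKernel_sub hF he _ _ (hne x hx)]
    have : ∑ y ∈ A, w y * (((Fintype.card F : ℂ) ^ n)⁻¹ *
        (quadraticChar F (x.2 - z) * quadGauss e) ^ n * e (-(x.1 ⬝ᵥ x.1) / (4 * (x.2 - z))) *
        e (((2 * (x.2 - z))⁻¹ • x.1) ⬝ᵥ y + -(4 * (x.2 - z))⁻¹ * (y ⬝ᵥ y))) =
        e (-(x.1 ⬝ᵥ x.1) / (4 * (x.2 - z))) * ((((Fintype.card F : ℂ) ^ n)⁻¹ *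
        (quadraticChar F (x.2 - z) * quadGauss e) ^ n) *
        ∑ y ∈ A, w y * e (((2 * (x.2 - z))⁻¹ • x.1) ⬝ᵥ y + -(4 * (x.2 - z))⁻¹ * (y ⬝ᵥ y))) := by
      simp_rw [mul_sum]
      exact sum_congr rfl fun y _ ↦ by ring
    rw [this, norm_mul, AddChar.norm_apply, one_mul]
  calc _ ≤ (#E' : ℝ) ^ 3 * ∑ x ∈ E', ‖∑ y ∈ A, w y * surfaceKernel e (x.1 - y, x.2 - z)‖ ^ 4 :=
        pow_sum_le_card_mul_sum_pow (fun _ _ ↦ norm_nonneg _) 3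
    _ ≤ (#E : ℝ) ^ 3 * ∑ x ∈ E', ‖∑ y ∈ A, w y * surfaceKernel e (x.1 - y, x.2 - z)‖ ^ 4 := by
        gcongr
        exact filter_subset _ _
    _ ≤ _ := by
        rw [sum_congr rfl hterm, ← mul_sum]
        gcongr
        calc _ = ∑ ξ ∈ E'.image Φ, H ξ ^ 4 := (sum_image hinj).symm
          _ ≤ ∑ ξ, H ξ ^ 4 := sum_le_univ_sum_of_nonneg fun _ ↦ by positivity
          _ ≤ _ := sum_norm_pow_four_le he A w hw

end Kernel

section Weak

variable {F : Type} [Field F] [Fintype F] [DecidableEq F] {e : AddChar F ℂ}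

/-- `L²` norm on the paraboloid of the Fourier transform of `g` restricted to `E`, squared. -/
theorem restriction_sq_le (he : e ≠ 1) {n : ℕ} (E : Finset ((Fin n → F) × F))
    (g : (Fin n → F) × F → ℂ) (hg : ∀ x, ‖g x‖ ≤ 1) :
    ((Fintype.card F : ℝ) ^ n)⁻¹ *
        ∑ y : Fin n → F, ‖∑ x ∈ E, g x * e (x.1 ⬝ᵥ y + x.2 * (y ⬝ᵥ y))‖ ^ 2 ≤
      #E + ∑ z : F, ∑ x ∈ E with x.2 ≠ z,
        ‖∑ y ∈ (E.filter (fun x ↦ x.2 = z)).image Prod.fst,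
          (starRingEnd ℂ) (g (y, z)) * surfaceKernel e (x.1 - y, x.2 - z)‖ := by
  set S : ℂ := ∑ x ∈ E, g x * ∑ z : F, ∑ y ∈ (E.filter (fun x ↦ x.2 = z)).image Prod.fst,
    (starRingEnd ℂ) (g (y, z)) * surfaceKernel e (x.1 - y, x.2 - z) with hS
  have hfib (x : (Fin n → F) × F) : ∑ z : F, ∑ y ∈ (E.filter (fun x ↦ x.2 = z)).image Prod.fst,
      (starRingEnd ℂ) (g (y, z)) * surfaceKernel e (x.1 - y, x.2 - z) =
      ∑ x' ∈ E, (starRingEnd ℂ) (g x') * surfaceKernel e (x - x') := by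
    rw [← sum_fiberwise E (fun x ↦ x.2)]
    refine sum_congr rfl fun z _ ↦ ?_
    rw [sum_image]
    · refine sum_congr rfl fun x' hx' ↦ ?_
      rw [← (mem_filter.mp hx').2]
      rfl
    · intro a ha b hb hab
      exact Prod.ext hab ((mem_filter.mp ha).2.trans (mem_filter.mp hb).2.symm)
  have h1 : ((((Fintype.card F : ℝ) ^ n)⁻¹ *
      ∑ y : Fin n → F, ‖∑ x ∈ E, g x * e (x.1 ⬝ᵥ y + x.2 * (y ⬝ᵥ y))‖ ^ 2 : ℝ) : ℂ) = S := by
    simp_rw [hS, hfib, mul_sum, surfaceKernel]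
    push_cast
    simp_rw [← Complex.mul_conj', map_sum, sum_mul_sum, mul_sum]
    rw [sum_comm]
    refine sum_congr rfl fun x _ ↦ ?_
    rw [sum_comm]
    refine sum_congr rfl fun x' _ ↦ sum_congr rfl fun y _ ↦ ?_
    have : e ((x - x').1 ⬝ᵥ y + (x - x').2 * (y ⬝ᵥ y)) = e (x.1 ⬝ᵥ y + x.2 * (y ⬝ᵥ y)) *
        (starRingEnd ℂ) (e (x'.1 ⬝ᵥ y + x'.2 * (y ⬝ᵥ y))) := by
      rw [← AddChar.map_neg_eq_conj, ← AddChar.map_add_eq_mul, Prod.fst_sub, Prod.snd_sub,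
        sub_dotProduct]
      congr 1
      ring
    rw [this, map_mul]
    ring
  have h2 := congrArg norm h1
  rw [Complex.norm_real, Real.norm_of_nonneg (by positivity)] at h2
  rw [h2, hS, sum_comm' (t' := E) (s' := fun x : (Fin n → F) × F ↦ univ.filter fun z ↦ x.2 ≠ z)
    (by simp [and_comm]), ← nsmul_one, ← sum_const, ← sum_add_distrib]
  refine (norm_sum_le _ _).trans (sum_le_sum fun x hx ↦ ?_)
  rw [norm_mul]
  refine (mul_le_of_le_one_left (norm_nonneg _) (hg x)).trans ?_
  rw [← sum_filter_add_sum_filter_not univ (fun z ↦ x.2 = z)]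
  refine (norm_add_le _ _).trans (add_le_add ?_ (norm_sum_le _ _))
  have hx' : x.1 ∈ (E.filter (fun y ↦ y.2 = x.2)).image Prod.fst :=
    mem_image_of_mem _ (mem_filter.mpr ⟨hx, rfl⟩)
  rw [filter_eq, if_pos (mem_univ _), sum_singleton]
  simp_rw [sub_self, surfaceKernel_of_snd_eq_zero he, sub_eq_zero, mul_ite, mul_one, mul_zero]
  rw [sum_ite_eq, if_pos hx', RCLike.norm_conj]
  exact hg x

theorem sum_rpow_le_card_mul {ι : Type*} [Fintype ι] (f : ι → ℝ) (hf : ∀ i, 0 ≤ f i) {θ : ℝ}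
    (h0 : 0 < θ) (h1 : θ ≤ 1) :
    ∑ i, f i ^ θ ≤ (Fintype.card ι : ℝ) ^ (1 - θ) * (∑ i, f i) ^ θ := by
  have hp : 1 ≤ θ⁻¹ := (one_le_inv₀ h0).mpr h1
  have h := Real.rpow_sum_le_const_mul_sum_rpow_of_nonneg (s := univ) (f := fun i ↦ f i ^ θ) hp
    fun i _ ↦ Real.rpow_nonneg (hf i) _
  simp_rw [Real.rpow_rpow_inv (hf _) h0.ne'] at h
  have hs : 0 ≤ ∑ i, f i ^ θ := sum_nonneg fun i _ ↦ Real.rpow_nonneg (hf i) _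
  have h2 := Real.rpow_le_rpow (by positivity) h h0.le
  rw [Real.rpow_inv_rpow hs h0.ne', Real.mul_rpow (by positivity) (sum_nonneg fun i _ ↦ hf i),
    ← Real.rpow_mul (by positivity), card_univ] at h2
  convert h2 using 3
  field_simp

/-- Summation of the slice bounds. -/
theorem sum_slices_le {ι : Type*} [Fintype ι] [Nonempty ι] (T f : ι → ℝ)
    (hf : ∀ i, 0 ≤ f i) {N : ℝ} (hN : ∑ i, f i = N) (m : ℕ)
    (h : ∀ i, T i ^ 4 ≤ N ^ 3 * (3 * (f i ^ 3 / (Fintype.card ι : ℝ) ^ (2 * m + 1) +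
      f i ^ 2 / (Fintype.card ι : ℝ) ^ m))) :
    ∑ i, T i ≤ 2 * (N ^ (3 / 2 : ℝ) * (Fintype.card ι : ℝ) ^ (-(m : ℝ) / 2) +
      N ^ (5 / 4 : ℝ) * (Fintype.card ι : ℝ) ^ ((2 - m : ℝ) / 4)) := by
  have hq : (0 : ℝ) < Fintype.card ι := by exact_mod_cast Fintype.card_pos
  set q := (Fintype.card ι : ℝ) with hqdef
  have hN0 : 0 ≤ N := hN ▸ sum_nonneg fun i _ ↦ hf i
  set α := N ^ (3 / 4 : ℝ) * q ^ (-(2 * m + 1 : ℝ) / 4) with hα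
  set β := N ^ (3 / 4 : ℝ) * q ^ (-(m : ℝ) / 4) with hβ
  have hα4 : α ^ 4 = N ^ 3 / q ^ (2 * m + 1) := by
    rw [hα, mul_pow, ← Real.rpow_mul_natCast hN0, ← Real.rpow_mul_natCast hq.le,
      div_eq_mul_inv (N ^ 3), ← Real.rpow_natCast, ← Real.rpow_natCast q, ← Real.rpow_neg hq.le]
    congr 2 <;> push_cast <;> ring
  have hβ4 : β ^ 4 = N ^ 3 / q ^ m := by
    rw [hβ, mul_pow, ← Real.rpow_mul_natCast hN0, ← Real.rpow_mul_natCast hq.le,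
      div_eq_mul_inv (N ^ 3), ← Real.rpow_natCast, ← Real.rpow_natCast q, ← Real.rpow_neg hq.le]
    congr 2 <;> push_cast <;> ring
  have hα0 : 0 ≤ α := by positivity
  have hβ0 : 0 ≤ β := by positivity
  have hTi (i) : T i ≤ 2 * (α * f i ^ (3 / 4 : ℝ) + β * f i ^ (1 / 2 : ℝ)) := by
    have hx : (f i ^ (3 / 4 : ℝ)) ^ 4 = f i ^ 3 := by
      rw [← Real.rpow_mul_natCast (hf i), ← Real.rpow_natCast]; norm_num
    have hy : (f i ^ (1 / 2 : ℝ)) ^ 4 = f i ^ 2 := by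
      rw [← Real.rpow_mul_natCast (hf i), ← Real.rpow_natCast]; norm_num
    set x := f i ^ (3 / 4 : ℝ)
    set y := f i ^ (1 / 2 : ℝ)
    have hx0 : 0 ≤ x := Real.rpow_nonneg (hf i) _
    have hy0 : 0 ≤ y := Real.rpow_nonneg (hf i) _
    refine le_of_pow_le_pow_left₀ four_ne_zero (by positivity) ?_
    have hax : 0 ≤ α * x := by positivity
    have hby : 0 ≤ β * y := by positivity
    calc T i ^ 4 ≤ _ := h i
      _ = 3 * ((α * x) ^ 4 + (β * y) ^ 4) := by
          rw [mul_pow α, mul_pow β, hα4, hβ4, hx, hy]; ring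
      _ ≤ 16 * ((α * x) ^ 4 + (β * y) ^ 4) := by gcongr; norm_num
      _ ≤ 16 * (α * x + β * y) ^ 4 := by
          gcongr
          exact pow_add_pow_le hax hby four_ne_zero
      _ = _ := by ring
  have h34 := sum_rpow_le_card_mul f hf (θ := 3 / 4) (by norm_num) (by norm_num)
  have h12 := sum_rpow_le_card_mul f hf (θ := 1 / 2) (by norm_num) (by norm_num)
  rw [hN, ← hqdef] at h34 h12
  calc ∑ i, T i ≤ ∑ i, 2 * (α * f i ^ (3 / 4 : ℝ) + β * f i ^ (1 / 2 : ℝ)) :=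
        sum_le_sum fun i _ ↦ hTi i
    _ = 2 * (α * ∑ i, f i ^ (3 / 4 : ℝ) + β * ∑ i, f i ^ (1 / 2 : ℝ)) := by
        rw [← mul_sum, sum_add_distrib, mul_sum, mul_sum]
    _ ≤ 2 * (α * (q ^ (1 - 3 / 4 : ℝ) * N ^ (3 / 4 : ℝ)) +
        β * (q ^ (1 - 1 / 2 : ℝ) * N ^ (1 / 2 : ℝ))) := by gcongr
    _ = 2 * ((N ^ (3 / 4 : ℝ) * N ^ (3 / 4 : ℝ)) *
          (q ^ (-(2 * m + 1 : ℝ) / 4) * q ^ (1 - 3 / 4 : ℝ)) +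
        (N ^ (3 / 4 : ℝ) * N ^ (1 / 2 : ℝ)) * (q ^ (-(m : ℝ) / 4) * q ^ (1 - 1 / 2 : ℝ))) := by
        rw [hα, hβ]; ring
    _ = _ := by
        rw [← Real.rpow_add_of_nonneg hN0 (by norm_num) (by norm_num),
          ← Real.rpow_add_of_nonneg hN0 (by norm_num) (by norm_num),
          ← Real.rpow_add hq, ← Real.rpow_add hq]
        congr 3 <;> [norm_num; skip; norm_num; skip] <;> congr 1 <;> ring

theorem restriction_indicator_le (hF : ringChar F ≠ 2) (he : e ≠ 1) {m : ℕ}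
    (E : Finset ((Fin (2 * m + 1) → F) × F)) (g : (Fin (2 * m + 1) → F) × F → ℂ)
    (hg : ∀ x, ‖g x‖ ≤ 1) :
    ((Fintype.card F : ℝ) ^ (2 * m + 1))⁻¹ *
        ∑ y : Fin (2 * m + 1) → F, ‖∑ x ∈ E, g x * e (x.1 ⬝ᵥ y + x.2 * (y ⬝ᵥ y))‖ ^ 2 ≤
      #E + 2 * ((#E : ℝ) ^ (3 / 2 : ℝ) * (Fintype.card F : ℝ) ^ (-(m : ℝ) / 2) +
      (#E : ℝ) ^ (5 / 4 : ℝ) * (Fintype.card F : ℝ) ^ ((2 - m : ℝ) / 4)) := by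
  have hq : (0 : ℝ) < Fintype.card F := by exact_mod_cast Fintype.card_pos
  refine (restriction_sq_le he E g hg).trans (add_le_add le_rfl ?_)
  have hcard (z : F) : #((E.filter (fun x ↦ x.2 = z)).image Prod.fst) = #{x ∈ E | x.2 = z} :=
    card_image_of_injOn fun a ha b hb hab ↦
      Prod.ext hab ((mem_filter.mp ha).2.trans (mem_filter.mp hb).2.symm)
  refine sum_slices_le _ (fun z ↦ (#{x ∈ E | x.2 = z} : ℝ))
    (fun z ↦ Nat.cast_nonneg _) ?_ m fun z ↦ ?_
  · rw [← Nat.cast_sum, ← card_eq_sum_card_fiberwise fun x _ ↦ mem_univ x.2]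
  · refine (slice_pow_four_le hF he E _ (fun y ↦ (starRingEnd ℂ) (g (y, z)))
      (fun y ↦ by rw [RCLike.norm_conj]; exact hg _) z).trans ?_
    refine mul_le_mul_of_nonneg_left ?_ (by positivity)
    have hen := energy_le hF he ((E.filter (fun x ↦ x.2 = z)).image Prod.fst)
    rw [hcard] at hen
    calc _ ≤ ((Fintype.card F : ℝ) ^ (2 * (2 * m + 1)))⁻¹ *
        ((Fintype.card F : ℝ) ^ (2 * m + 1 + 1) * (3 * ((#{x ∈ E | x.2 = z} : ℝ) ^ 3 / Fintype.card F +
          (Fintype.card F : ℝ) ^ m * (#{x ∈ E | x.2 = z} : ℝ) ^ 2))) := by gcongr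
      _ = _ := by
        field_simp
        ring

end Weak

section Interpolation

theorem le_rpow_of_sq_mul_sq_le {u N K s : ℝ} (hu : 0 < u) (hN : 0 ≤ N) (hK : 0 ≤ K) (hs : 0 < s)
    (h : u ^ 2 * N ^ 2 ≤ K * N ^ (2 - s)) : N ≤ (K / u ^ 2) ^ s⁻¹ := by
  rcases hN.eq_or_lt with rfl | hN
  · positivity
  rw [Real.le_rpow_inv_iff_of_pos hN.le (by positivity) hs, le_div_iff₀ (by positivity)]
  refine le_of_mul_le_mul_right ?_ (Real.rpow_pos_of_pos hN (2 - s))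
  rw [mul_right_comm, ← Real.rpow_add hN, add_sub_cancel, mul_comm]
  exact_mod_cast h

/-- An `L^{2+ε}` bound from an `L²` bound, an `L^∞` bound and a bound on the distribution
function. -/
theorem sum_rpow_le_of_distribution {ι : Type*} [Fintype ι] (h : ι → ℝ) (h0 : ∀ x, 0 ≤ h x)
    (h1 : ∀ x, h x ≤ 1) {ε u₀ : ℝ} (hε : 0 < ε) (hu₀ : 0 < u₀) (hu₁ : u₀ ≤ 1)
    (hL2 : ∑ x, h x ^ 2 ≤ u₀ ^ (-ε))
    (hD : ∀ u, u₀ ≤ u → u ^ (2 + ε) * #{x | u ≤ h x} ≤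
      3 * u ^ ε + 72 * (u / u₀) ^ (-1 / 6 : ℝ)) :
    ∑ x, h x ^ (2 + ε) ≤ 1 + 2 ^ (2 + ε) *
      (3 * (2 ^ ε / (2 ^ ε - 1)) + 72 * (1 - 2 ^ (-1 / 6 : ℝ))⁻¹) := by
  have two_le : ∀ a b : ℝ, a ≤ b → (2 : ℝ) ^ a ≤ 2 ^ b := fun a b hab ↦
    Real.rpow_le_rpow_of_exponent_le one_le_two hab
  obtain ⟨k, hk1, hk2⟩ := exists_nat_pow_near (one_le_inv₀ hu₀ |>.mpr hu₁) (one_lt_two (α := ℝ))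
  set v : ℕ → ℝ := fun j ↦ 2 ^ j * u₀ with hv
  have hvpos (j) : 0 < v j := by positivity
  have hptw (x) : h x ^ (2 + ε) ≤ u₀ ^ ε * h x ^ 2 +
      ∑ j ∈ range (k + 1), if v j ≤ h x then (2 * v j) ^ (2 + ε) else 0 := by
    have hs : ∀ j ∈ range (k + 1), 0 ≤ if v j ≤ h x then (2 * v j) ^ (2 + ε) else 0 := by
      intro j _
      have := hvpos j
      split_ifs <;> positivity
    rcases le_total (h x) u₀ with hx | hx
    · refine le_add_of_le_of_nonneg ?_ (sum_nonneg hs)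
      rw [add_comm, Real.rpow_add_of_nonneg (h0 x) hε.le zero_le_two, Real.rpow_two]
      have := h0 x
      gcongr
    · obtain ⟨j, hj1, hj2⟩ := exists_nat_pow_near ((one_le_div hu₀).mpr hx) (one_lt_two (α := ℝ))
      rw [le_div_iff₀ hu₀] at hj1
      rw [div_lt_iff₀ hu₀] at hj2
      refine le_add_of_nonneg_of_le (by positivity) ?_
      have hjk : j ∈ range (k + 1) := by
        rw [mem_range]
        refine (pow_lt_pow_iff_right₀ (one_lt_two (α := ℝ))).mp (lt_of_le_of_lt ?_ hk2)
        rw [← one_div, le_div_iff₀ hu₀]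
        exact hj1.trans (h1 x)
      refine le_trans ?_ (single_le_sum hs hjk)
      rw [if_pos hj1]
      refine Real.rpow_le_rpow (h0 x) (hj2.le.trans_eq ?_) (by positivity)
      simp only [hv]; ring
  have hg1 : ∑ j ∈ range (k + 1), v j ^ ε ≤ 2 ^ ε / (2 ^ ε - 1) := by
    have h2 : (1 : ℝ) < 2 ^ ε := Real.one_lt_rpow one_lt_two hε
    have hvj (j) : v j ^ ε = (2 ^ ε) ^ j * u₀ ^ ε := by
      rw [hv, Real.mul_rpow (by positivity) hu₀.le, Real.rpow_pow_comm zero_le_two]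
    simp_rw [hvj]
    rw [← sum_mul, geom_sum_eq h2.ne', div_mul_eq_mul_div]
    have : (0 : ℝ) ≤ 2 ^ ε - 1 := by linarith
    gcongr
    calc ((2 ^ ε) ^ (k + 1) - 1) * u₀ ^ ε ≤ (2 ^ ε) ^ (k + 1) * u₀ ^ ε := by
          gcongr; linarith
      _ = (2 ^ (k + 1) * u₀) ^ ε := (hvj (k + 1)).symm
      _ ≤ 2 ^ ε := by
          refine Real.rpow_le_rpow (by positivity) ?_ hε.le
          rw [← one_div, le_div_iff₀ hu₀] at hk1
          rw [pow_succ]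
          linarith
  have hg2 : ∑ j ∈ range (k + 1), (v j / u₀) ^ (-1 / 6 : ℝ) ≤ (1 - 2 ^ (-1 / 6 : ℝ))⁻¹ := by
    have hlt : (2 : ℝ) ^ (-1 / 6 : ℝ) < 1 :=
      Real.rpow_lt_one_of_one_lt_of_neg one_lt_two (by norm_num)
    have hvj (j) : (v j / u₀) ^ (-1 / 6 : ℝ) = (2 ^ (-1 / 6 : ℝ)) ^ j := by
      rw [hv, mul_div_cancel_right₀ _ hu₀.ne', Real.rpow_pow_comm zero_le_two]
    simp_rw [hvj]
    rw [← tsum_geometric_of_lt_one (by positivity) hlt]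
    exact (summable_geometric_of_lt_one (by positivity) hlt).sum_le_tsum _
      fun _ _ ↦ by positivity
  calc ∑ x, h x ^ (2 + ε) ≤ ∑ x, (u₀ ^ ε * h x ^ 2 +
        ∑ j ∈ range (k + 1), if v j ≤ h x then (2 * v j) ^ (2 + ε) else 0) :=
        sum_le_sum fun x _ ↦ hptw x
    _ = u₀ ^ ε * ∑ x, h x ^ 2 +
        2 ^ (2 + ε) * ∑ j ∈ range (k + 1), v j ^ (2 + ε) * #{x | v j ≤ h x} := by
        rw [sum_add_distrib, ← mul_sum, sum_comm, mul_sum (range (k + 1))]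
        congr 1
        refine sum_congr rfl fun j _ ↦ ?_
        rw [← sum_filter, sum_const, nsmul_eq_mul, Real.mul_rpow zero_le_two (hvpos j).le]
        ring
    _ ≤ u₀ ^ ε * u₀ ^ (-ε) + 2 ^ (2 + ε) * ∑ j ∈ range (k + 1),
        (3 * v j ^ ε + 72 * (v j / u₀) ^ (-1 / 6 : ℝ)) := by
        gcongr with j _
        exact hD _ (le_mul_of_one_le_left hu₀.le (one_le_pow₀ one_le_two))
    _ ≤ _ := by
        rw [← Real.rpow_add hu₀, add_neg_cancel, Real.rpow_zero, sum_add_distrib, ← mul_sum,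
          ← mul_sum]
        gcongr

end Interpolation

section Extension

variable {F : Type} [Field F] [Fintype F] {e : AddChar F ℂ}

/-- The extension operator of the paraboloid, written with dot products. -/
noncomputable def extension (e : AddChar F ℂ) {n : ℕ}
    (f : (Fin n → F) → ℂ) (x : (Fin n → F) × F) : ℂ :=
  ((Fintype.card F : ℂ) ^ n)⁻¹ * ∑ y : Fin n → F, f y * e (x.1 ⬝ᵥ y + x.2 * (y ⬝ᵥ y))

theorem norm_extension_le_one {n : ℕ} (f : (Fin n → F) → ℂ)
    (hf : ((Fintype.card F : ℝ) ^ n)⁻¹ * ∑ y, ‖f y‖ ^ 2 ≤ 1) (x : (Fin n → F) × F) :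
    ‖extension e f x‖ ≤ 1 := by
  have hq : (0 : ℝ) < Fintype.card F := by exact_mod_cast Fintype.card_pos
  have hle : ‖∑ y : Fin n → F, f y * e (x.1 ⬝ᵥ y + x.2 * (y ⬝ᵥ y))‖ ≤ ∑ y, ‖f y‖ :=
    (norm_sum_le _ _).trans_eq <| sum_congr rfl fun y _ ↦ by
      rw [norm_mul, AddChar.norm_apply, mul_one]
  have hcs := sq_sum_le_card_mul_sum_sq (s := univ) (f := fun y : Fin n → F ↦ ‖f y‖)
  rw [card_univ, Fintype.card_fun, Fintype.card_fin, Nat.cast_pow] at hcs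
  rw [inv_mul_le_iff₀ (by positivity), mul_one] at hf
  rw [extension, norm_mul, norm_inv, norm_pow, RCLike.norm_natCast,
    inv_mul_le_iff₀ (by positivity), mul_one]
  refine hle.trans (abs_le_of_sq_le_sq' ?_ (by positivity)).2
  calc _ ≤ _ := hcs
    _ ≤ _ := by rw [sq]; gcongr

theorem extension_smul {n : ℕ} (c : ℂ) (f : (Fin n → F) → ℂ) (x : (Fin n → F) × F) :
    extension e (fun y ↦ c * f y) x = c * extension e f x := by
  simp_rw [extension, mul_assoc, ← mul_sum]
  ring

variable [DecidableEq F]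

theorem sum_norm_extension_sq (he : e ≠ 1) {n : ℕ} (f : (Fin n → F) → ℂ) :
    ∑ x, ‖extension e f x‖ ^ 2 =
      Fintype.card F * (((Fintype.card F : ℝ) ^ n)⁻¹ * ∑ y, ‖f y‖ ^ 2) := by
  have hq : (0 : ℝ) < Fintype.card F := by exact_mod_cast Fintype.card_pos
  simp_rw [extension, norm_mul, mul_pow]
  rw [← mul_sum, sum_norm_sq_univ (fun (x : (Fin n → F) × F) y ↦ e (x.1 ⬝ᵥ y + x.2 * (y ⬝ᵥ y)))
    ((Fintype.card F : ℝ) ^ (n + 1))]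
  · simp only [norm_inv, norm_pow, RCLike.norm_natCast]
    field_simp
    ring
  · intro v w
    have h := char_orthogonality_prod he (v, v ⬝ᵥ v) (w, w ⬝ᵥ w)
    rw [Fintype.card_fin] at h
    rw [h]
    refine if_congr ⟨fun h ↦ congrArg Prod.fst h, fun h ↦ by rw [h]⟩ rfl rfl

theorem sq_mul_card_sq_le (hF : ringChar F ≠ 2) (he : e ≠ 1) {m : ℕ}
    (f : (Fin (2 * m + 1) → F) → ℂ)
    (hf : ((Fintype.card F : ℝ) ^ (2 * m + 1))⁻¹ * ∑ y, ‖f y‖ ^ 2 ≤ 1) {u : ℝ} (hu : 0 < u)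
    (E : Finset ((Fin (2 * m + 1) → F) × F)) (hE : ∀ x ∈ E, u ≤ ‖extension e f x‖) :
    u ^ 2 * (#E : ℝ) ^ 2 ≤
      #E + 2 * ((#E : ℝ) ^ (3 / 2 : ℝ) * (Fintype.card F : ℝ) ^ (-(m : ℝ) / 2) +
      (#E : ℝ) ^ (5 / 4 : ℝ) * (Fintype.card F : ℝ) ^ ((2 - m : ℝ) / 4)) := by
  set c : ℝ := ((Fintype.card F : ℝ) ^ (2 * m + 1))⁻¹ with hc
  have hc0 : 0 ≤ c := by positivity
  set g : (Fin (2 * m + 1) → F) × F → ℂ :=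
    fun x ↦ (starRingEnd ℂ) (extension e f x) / ‖extension e f x‖ with hgdef
  have hg (x) : ‖g x‖ ≤ 1 := by
    rw [hgdef, norm_div, RCLike.norm_conj, Complex.norm_real, norm_norm]
    exact div_self_le_one _
  have hgh (x) : g x * extension e f x = (‖extension e f x‖ : ℂ) := by
    rw [hgdef, div_mul_eq_mul_div, mul_comm, Complex.mul_conj', sq, mul_self_div_self]
  set G : (Fin (2 * m + 1) → F) → ℂ := fun y ↦ ∑ x ∈ E, g x * e (x.1 ⬝ᵥ y + x.2 * (y ⬝ᵥ y))
    with hG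
  have hsum : (∑ x ∈ E, ‖extension e f x‖ : ℝ) = c * ‖∑ y, f y * G y‖ := by
    have h : ((∑ x ∈ E, ‖extension e f x‖ : ℝ) : ℂ) = c * ∑ y, f y * G y := by
      push_cast
      simp_rw [← hgh, hG, extension, mul_sum]
      rw [sum_comm]
      refine sum_congr rfl fun y _ ↦ sum_congr rfl fun x _ ↦ ?_
      rw [hc]
      push_cast
      ring
    have h' := congrArg norm h
    rwa [Complex.norm_real, Real.norm_of_nonneg (by positivity), norm_mul, Complex.norm_real,
      Real.norm_of_nonneg hc0] at h'
  have hle : u * #E ≤ c * ∑ y, ‖f y‖ * ‖G y‖ := by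
    calc u * #E = ∑ x ∈ E, u := by rw [sum_const, nsmul_eq_mul, mul_comm]
      _ ≤ _ := sum_le_sum hE
      _ = _ := hsum
      _ ≤ _ := by
        gcongr
        exact (norm_sum_le _ _).trans_eq (sum_congr rfl fun y _ ↦ norm_mul _ _)
  calc u ^ 2 * (#E : ℝ) ^ 2 = (u * #E) ^ 2 := by ring
    _ ≤ (c * ∑ y, ‖f y‖ * ‖G y‖) ^ 2 := by gcongr
    _ = c ^ 2 * (∑ y, ‖f y‖ * ‖G y‖) ^ 2 := by ring
    _ ≤ c ^ 2 * ((∑ y, ‖f y‖ ^ 2) * ∑ y, ‖G y‖ ^ 2) := by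
        gcongr
        exact sum_mul_sq_le_sq_mul_sq _ _ _
    _ = (c * ∑ y, ‖f y‖ ^ 2) * (c * ∑ y, ‖G y‖ ^ 2) := by ring
    _ ≤ c * ∑ y, ‖G y‖ ^ 2 := mul_le_of_le_one_left (by positivity) hf
    _ ≤ _ := restriction_indicator_le hF he E g hg

/-- Solving the restricted restriction estimate for the size of the set. -/
theorem card_le_of_sq_mul_sq_le {u N A B : ℝ} (hu : 0 < u) (hN : 0 ≤ N) (hA : 0 ≤ A) (hB : 0 ≤ B)
    (h : u ^ 2 * N ^ 2 ≤ N + 2 * (N ^ (3 / 2 : ℝ) * A + N ^ (5 / 4 : ℝ) * B)) :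
    N ≤ 3 / u ^ 2 + (6 * A / u ^ 2) ^ (2 : ℝ) + (6 * B / u ^ 2) ^ (4 / 3 : ℝ) := by
  have key : N ≤ 3 / u ^ 2 ∨ N ≤ (6 * A / u ^ 2) ^ (2 : ℝ) ∨ N ≤ (6 * B / u ^ 2) ^ (4 / 3 : ℝ) := by
    have hmax : u ^ 2 * N ^ 2 ≤ 3 * N ∨ u ^ 2 * N ^ 2 ≤ 6 * A * N ^ (3 / 2 : ℝ) ∨
        u ^ 2 * N ^ 2 ≤ 6 * B * N ^ (5 / 4 : ℝ) := by
      by_contra! hcon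
      obtain ⟨h1, h2, h3⟩ := hcon
      linarith
    rcases hmax with h1 | h1 | h1
    · left
      have := le_rpow_of_sq_mul_sq_le (K := 3) (s := 1) hu hN (by norm_num) one_pos
        (h1.trans_eq (by norm_num))
      simpa using this
    · right; left
      have := le_rpow_of_sq_mul_sq_le (K := 6 * A) (s := 1 / 2) hu hN (by positivity) (by norm_num)
        (h1.trans_eq (by norm_num))
      exact this.trans_eq (by norm_num)
    · right; right
      have := le_rpow_of_sq_mul_sq_le (K := 6 * B) (s := 3 / 4) hu hN (by positivity) (by norm_num)
        (h1.trans_eq (by norm_num))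
      exact this.trans_eq (by norm_num)
  have h1 : 0 ≤ 3 / u ^ 2 := by positivity
  have h2 : 0 ≤ (6 * A / u ^ 2) ^ (2 : ℝ) := by positivity
  have h3 : 0 ≤ (6 * B / u ^ 2) ^ (4 / 3 : ℝ) := by positivity
  rcases key with h | h | h <;> linarith

/-- The distribution function bound, in terms of the critical height `u₀`. -/
theorem rpow_mul_card_le {q u m N : ℝ} (hq : 1 ≤ q) (hm : 3 ≤ m) (hN : 0 ≤ N)
    (hu : q ^ (-(m + 1) / 2) ≤ u)
    (h : u ^ 2 * N ^ 2 ≤ N + 2 * (N ^ (3 / 2 : ℝ) * q ^ (-m / 2) +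
      N ^ (5 / 4 : ℝ) * q ^ ((2 - m) / 4))) :
    u ^ (2 + 2 / (m + 1)) * N ≤ 3 * u ^ (2 / (m + 1)) +
      72 * (u / q ^ (-(m + 1) / 2)) ^ (-1 / 6 : ℝ) := by
  have hq0 : 0 < q := by linarith
  set u₀ := q ^ (-(m + 1) / 2) with hu₀
  have hu₀pos : 0 < u₀ := by positivity
  have hu0 : 0 < u := hu₀pos.trans_le hu
  set ε := 2 / (m + 1) with hε
  have hε0 : 0 < ε := by positivity
  have hε2 : ε ≤ 1 / 2 := by
    rw [hε, div_le_div_iff₀ (by positivity) (by positivity)]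
    linarith
  have hqu (t : ℝ) : q ^ t = u₀ ^ (-ε * t) := by
    rw [hu₀, ← Real.rpow_mul hq0.le, hε]
    congr 1
    field_simp
  have hNle := card_le_of_sq_mul_sq_le hu0 hN (Real.rpow_nonneg hq0.le _)
    (Real.rpow_nonneg hq0.le _) h
  have hratio : 1 ≤ u / u₀ := (one_le_div hu₀pos).mpr hu
  have e1 : u ^ (2 + ε) * (3 / u ^ 2) = 3 * u ^ ε := by
    rw [Real.rpow_add hu0, Real.rpow_two]
    field_simp
  have split (K s t : ℝ) (hK : 0 ≤ K) : u ^ (2 + ε) * (6 * K / u ^ 2) ^ s =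
      6 ^ s * (u ^ (2 + ε - 2 * s) * K ^ s) := by
    rw [Real.div_rpow (by positivity) (by positivity), Real.mul_rpow (by norm_num) hK,
      ← Real.rpow_natCast, ← Real.rpow_mul hu0.le, Real.rpow_sub hu0]
    push_cast
    ring
  have hε1 : ε * (m + 1) = 2 := by rw [hε]; field_simp
  have e2 : u ^ (2 + ε) * (6 * q ^ (-m / 2) / u ^ 2) ^ (2 : ℝ) ≤
      36 * (u / u₀) ^ (-1 / 6 : ℝ) := by
    rw [split _ _ 0 (by positivity), ← Real.rpow_mul hq0.le, hqu,
      show -ε * (-m / 2 * 2) = -(2 + ε - 2 * 2) by linarith, Real.rpow_neg hu₀pos.le,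
      ← div_eq_mul_inv, ← Real.div_rpow hu0.le hu₀pos.le]
    refine mul_le_mul (by norm_num) (Real.rpow_le_rpow_of_exponent_le hratio (by linarith))
      (by positivity) (by positivity)
  have e3 : u ^ (2 + ε) * (6 * q ^ ((2 - m) / 4) / u ^ 2) ^ (4 / 3 : ℝ) ≤
      36 * (u / u₀) ^ (-1 / 6 : ℝ) := by
    rw [split _ _ 0 (by positivity), ← Real.rpow_mul hq0.le, hqu,
      show -ε * ((2 - m) / 4 * (4 / 3)) = -(2 + ε - 2 * (4 / 3)) by linarith,
      Real.rpow_neg hu₀pos.le,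
      ← div_eq_mul_inv, ← Real.div_rpow hu0.le hu₀pos.le]
    refine mul_le_mul ?_ (Real.rpow_le_rpow_of_exponent_le hratio (by linarith))
      (by positivity) (by positivity)
    calc (6 : ℝ) ^ (4 / 3 : ℝ) ≤ 6 ^ (2 : ℝ) :=
          Real.rpow_le_rpow_of_exponent_le (by norm_num) (by norm_num)
      _ = 36 := by norm_num
  calc u ^ (2 + ε) * N ≤ u ^ (2 + ε) * (3 / u ^ 2 + (6 * q ^ (-m / 2) / u ^ 2) ^ (2 : ℝ) +
        (6 * q ^ ((2 - m) / 4) / u ^ 2) ^ (4 / 3 : ℝ)) := by gcongr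
    _ ≤ _ := by
        rw [mul_add, mul_add]
        linarith

/-- The extension estimate for functions of `L²` norm at most one. -/
theorem sum_norm_extension_rpow_le (hF : ringChar F ≠ 2) (he : e ≠ 1) {m : ℕ} (hm : 3 ≤ m)
    (f : (Fin (2 * m + 1) → F) → ℂ)
    (hf : ((Fintype.card F : ℝ) ^ (2 * m + 1))⁻¹ * ∑ y, ‖f y‖ ^ 2 ≤ 1) {ε : ℝ}
    (hε : ε = 2 / (m + 1)) :
    ∑ x, ‖extension e f x‖ ^ (2 + ε) ≤ 1 + 2 ^ (2 + ε) *
      (3 * (2 ^ ε / (2 ^ ε - 1)) + 72 * (1 - 2 ^ (-1 / 6 : ℝ))⁻¹) := by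
  have hq : (1 : ℝ) ≤ Fintype.card F := by exact_mod_cast Fintype.card_pos
  have hq0 : (0 : ℝ) < Fintype.card F := by linarith
  refine sum_rpow_le_of_distribution _ (fun x ↦ norm_nonneg _) (norm_extension_le_one f hf)
    (u₀ := (Fintype.card F : ℝ) ^ (-(m + 1 : ℝ) / 2)) (by rw [hε]; positivity) (by positivity)
    (Real.rpow_le_one_of_one_le_of_nonpos hq (by linarith [m.cast_nonneg (α := ℝ)])) ?_
    fun u hu ↦ ?_
  · rw [sum_norm_extension_sq he, ← Real.rpow_mul hq0.le,
      show -(m + 1 : ℝ) / 2 * -ε = 1 by rw [hε]; field_simp, Real.rpow_one]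
    exact mul_le_of_le_one_right hq0.le hf
  · rw [hε]
    refine rpow_mul_card_le hq (by exact_mod_cast hm) (Nat.cast_nonneg _) hu
      (sq_mul_card_sq_le hF he f hf ((by positivity : (0 : ℝ) < _).trans_le hu) _
        fun x hx ↦ (mem_filter.mp hx).2)

/-- The `L² → L^r` extension estimate with `r = 2 + 2 / (m + 1)`. -/
theorem exists_extension_le {m : ℕ} (hm : 3 ≤ m) {r : ℝ} (hr : r = 2 + 2 / (m + 1)) :
    ∃ C : ℝ, 0 < C ∧ ∀ (F : Type) [Field F] [Fintype F], ringChar F ≠ 2 →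
      ∀ (e : AddChar F ℂ), e ≠ 1 → ∀ f : (Fin (2 * m + 1) → F) → ℂ,
        (∑ x, ‖extension e f x‖ ^ r) ^ r⁻¹ ≤
          C * √(((Fintype.card F : ℝ) ^ (2 * m + 1))⁻¹ * ∑ y, ‖f y‖ ^ 2) := by
  have hε : (0 : ℝ) < 2 / (m + 1) := by positivity
  have hr0 : 0 < r := by rw [hr]; positivity
  set K : ℝ := 1 + 2 ^ r * (3 * (2 ^ (2 / (m + 1) : ℝ) / (2 ^ (2 / (m + 1) : ℝ) - 1)) +
    72 * (1 - 2 ^ (-1 / 6 : ℝ))⁻¹) with hK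
  have hK0 : 0 < K := by
    have h1 : (0 : ℝ) < 2 ^ (2 / (m + 1) : ℝ) - 1 :=
      sub_pos.mpr (Real.one_lt_rpow one_lt_two hε)
    have h2 : (0 : ℝ) < 1 - 2 ^ (-1 / 6 : ℝ) :=
      sub_pos.mpr (Real.rpow_lt_one_of_one_lt_of_neg one_lt_two (by norm_num))
    positivity
  refine ⟨K ^ r⁻¹, by positivity, fun F _ _ hF e he f ↦ ?_⟩
  classical
  have hq0 : (0 : ℝ) < Fintype.card F := by exact_mod_cast Fintype.card_pos
  set A := √(((Fintype.card F : ℝ) ^ (2 * m + 1))⁻¹ * ∑ y, ‖f y‖ ^ 2) with hA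
  have hA2 : A ^ 2 = ((Fintype.card F : ℝ) ^ (2 * m + 1))⁻¹ * ∑ y, ‖f y‖ ^ 2 :=
    Real.sq_sqrt (by positivity)
  have hAnonneg : 0 ≤ A := Real.sqrt_nonneg _
  rcases hAnonneg.eq_or_lt with hA0 | hA0
  · have hpl := sum_norm_extension_sq he f
    rw [← hA2, ← hA0, sq, mul_zero, mul_zero,
      sum_eq_zero_iff_of_nonneg fun _ _ ↦ by positivity] at hpl
    rw [sum_eq_zero fun x hx ↦ ?_, Real.zero_rpow (inv_ne_zero hr0.ne')]
    · positivity
    · rw [pow_eq_zero_iff two_ne_zero |>.mp (hpl x hx), Real.zero_rpow hr0.ne']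
  · have h := sum_norm_extension_rpow_le hF he hm (fun y ↦ (A : ℂ)⁻¹ * f y) ?_ rfl
    · simp_rw [extension_smul, norm_mul, norm_inv, Complex.norm_real, Real.norm_of_nonneg hA0.le,
        Real.mul_rpow (inv_nonneg.mpr hA0.le) (norm_nonneg _)] at h
      rw [← mul_sum, ← hr, ← hK, Real.inv_rpow hA0.le, inv_mul_le_iff₀ (by positivity)] at h
      have h' := Real.rpow_le_rpow (by positivity) h (inv_nonneg.mpr hr0.le)
      rwa [Real.mul_rpow (by positivity) hK0.le, Real.rpow_rpow_inv hA0.le hr0.ne',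
        mul_comm A] at h'
    · simp_rw [norm_mul, norm_inv, Complex.norm_real, Real.norm_of_nonneg hA0.le, mul_pow]
      rw [← mul_sum, mul_left_comm, ← hA2, ← mul_pow, inv_mul_cancel₀ hA0.ne', one_pow]

end Extension

end ParaboloidRestriction

/-- For every even `d ≥ 8` there is a constant `C = C(d) > 0` such that for every finite
field `F` of odd characteristic, every nontrivial additive character `e` of `F`, and every
`f : P → ℂ`, one has `‖(f dσ)^∨‖_{L^{(2d+4)/d}(F^d)} ≤ C ‖f‖_{L^2(P,dσ)}`. -/
theorem stmt0 (d : ℕ) (hd8 : 8 ≤ d) (hdeven : Even d) :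
    ∃ C : ℝ, 0 < C ∧
      ∀ (F : Type) [Field F] [Fintype F], ringChar F ≠ 2 →
      ∀ (e : AddChar F ℂ), e ≠ 1 →
      ∀ f : (Fin (d - 1) → F) → ℂ,
        (∑ x : (Fin (d - 1) → F) × F,
            ‖extOp e f x‖ ^ ((2 * (d : ℝ) + 4) / d)) ^ ((d : ℝ) / (2 * d + 4))
          ≤ C * (((Fintype.card F : ℝ) ^ (d - 1))⁻¹ *
              ∑ y : Fin (d - 1) → F, ‖f y‖ ^ 2) ^ ((1 : ℝ) / 2) := by
  obtain ⟨m, rfl⟩ : ∃ m, d = 2 * m + 1 + 1 := by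
    obtain ⟨k, rfl⟩ := hdeven
    exact ⟨k - 1, by omega⟩
  obtain ⟨C, hC, h⟩ := ParaboloidRestriction.exists_extension_le (m := m) (by omega) rfl
  refine ⟨C, hC, fun F _ _ hF e he f ↦ ?_⟩
  have h := h F hF e he f
  have hr : (2 + 2 / (m + 1) : ℝ) = (2 * ((2 * m + 1 + 1 : ℕ) : ℝ) + 4) / (2 * m + 1 + 1 : ℕ) := by
    push_cast
    field_simp
    ring
  rwa [hr, inv_div, Real.sqrt_eq_rpow] at h
end

section
/- Let d = 6. For every ε > 0 there exists a constant C(ε) > 0 such that for every finite field F of odd characteristic, every nontrivial additive character e of F, and every function f : P → ℂ on the paraboloid P ⊆ F^6, one has ‖(f dσ)^∨‖_{L^{8/3+ε}(F^6)} ≤ C(ε) ‖f‖_{L^2(P,dσ)}. -/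
open Finset

open scoped ComplexConjugate

section CharacterSums

theorem map_sum_addChar {A ι : Type*} [AddCommMonoid A] [Fintype ι] (e : AddChar A ℂ)
    (g : ι → A) : e (∑ i, g i) = ∏ i, e (g i) := by
  exact map_prod e.toMonoidHom (fun i => Multiplicative.ofAdd (g i)) univ

variable {F : Type} [Field F] [Fintype F] [DecidableEq F]

theorem sum_addChar_mul {e : AddChar F ℂ} (he : e ≠ 1) (a : F) :
    ∑ x, e (x * a) = if a = 0 then (Fintype.card F : ℂ) else 0 := by
  have := AddChar.sum_mulShift a (AddChar.IsPrimitive.of_ne_one he)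
  simpa using this

theorem sum_addChar_dotProduct {e : AddChar F ℂ} (he : e ≠ 1) {n : ℕ} (w : Fin n → F) :
    ∑ u : Fin n → F, e (u ⬝ᵥ w) = if w = 0 then (Fintype.card F : ℂ) ^ n else 0 := by
  have h : ∀ u : Fin n → F, e (u ⬝ᵥ w) = ∏ i, e (u i * w i) := fun u => by
    simp only [dotProduct]
    exact map_sum_addChar e _
  simp_rw [h]
  have h2 := Finset.prod_univ_sum (fun _ : Fin n => (univ : Finset F)) (fun i x => e (x * w i))
  rw [Fintype.piFinset_univ] at h2
  rw [← h2]
  simp_rw [sum_addChar_mul he]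
  split_ifs with hw
  · simp [hw]
  · obtain ⟨i, hi⟩ := Function.ne_iff.mp hw
    exact Finset.prod_eq_zero (mem_univ i) (if_neg hi)

/-- The quadratic Gauss sum `∑ e(s x²)`. -/
noncomputable def quadGauss (e : AddChar F ℂ) (s : F) : ℂ := ∑ x : F, e (s * (x * x))

omit [DecidableEq F] in
theorem norm_quadGauss_sq (hF : ringChar F ≠ 2) {e : AddChar F ℂ} (he : e ≠ 1) {s : F}
    (hs : s ≠ 0) : ‖quadGauss e s‖ ^ 2 = Fintype.card F := by
  classical
  have h2 : (2 : F) ≠ 0 := Ring.two_ne_zero hF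
  have key : quadGauss e s * conj (quadGauss e s) = Fintype.card F := by
    have h1 : quadGauss e s * conj (quadGauss e s) =
        ∑ y : F, ∑ x : F, e (s * (x * x) - s * (y * y)) := by
      simp only [quadGauss, map_sum, sum_mul_sum]
      rw [sum_comm]
      refine sum_congr rfl fun y _ => sum_congr rfl fun x _ => ?_
      rw [← AddChar.map_neg_eq_conj, ← AddChar.map_add_eq_mul, sub_eq_add_neg]
    have h3 : ∀ y : F, ∑ x : F, e (s * (x * x) - s * (y * y)) =
        ∑ z : F, e (s * (z * z)) * e (y * (2 * s * z)) := fun y => by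
      rw [← Equiv.sum_comp (Equiv.addRight y)]
      refine sum_congr rfl fun z _ => ?_
      rw [← AddChar.map_add_eq_mul, Equiv.coe_addRight]
      congr 1; ring
    simp_rw [h1, h3]
    rw [sum_comm]
    simp_rw [← mul_sum, sum_addChar_mul he]
    simp [h2, hs]
  have : ((‖quadGauss e s‖ ^ 2 : ℝ) : ℂ) = ((Fintype.card F : ℝ) : ℂ) := by
    rw [← Complex.normSq_eq_norm_sq, Complex.normSq_eq_conj_mul_self, mul_comm, key]
    simp
  exact_mod_cast this

theorem sum_comp_mul_self (hF : ringChar F ≠ 2) (φ : F → ℂ) :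
    ∑ x : F, φ (x * x) = ∑ y : F, (1 + (quadraticChar F y : ℂ)) * φ y := by
  have h : ∀ y : F, (1 + (quadraticChar F y : ℂ)) = #{x : F | x * x = y} := fun y => by
    have := quadraticChar_card_sqrts hF y
    rw [add_comm]
    have h' : ((#{x : F | x * x = y} : ℤ)) = quadraticChar F y + 1 := by
      rw [← this]
      congr 2
      ext x; simp [sq]
    exact_mod_cast h'.symm
  rw [← Finset.sum_fiberwise' univ (fun x : F => x * x) φ]
  refine sum_congr rfl fun y _ => ?_
  rw [h]; simp

theorem quadGauss_mul_nonsquare (hF : ringChar F ≠ 2) {e : AddChar F ℂ} (he : e ≠ 1) {r s : F}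
    (hr : ¬ IsSquare r) (hs : s ≠ 0) : quadGauss e (r * s) = - quadGauss e s := by
  have hr0 : r ≠ 0 := by rintro rfl; exact hr (by simp)
  have hmul : ∀ x, Equiv.mulLeft₀ r hr0 x = r * x := fun _ => rfl
  have hχ : quadraticChar F r = -1 := quadraticChar_neg_one_iff_not_isSquare.mpr hr
  rw [eq_neg_iff_add_eq_zero]
  have h1 := sum_comp_mul_self hF (fun x => e (s * x))
  have h2 := sum_comp_mul_self hF (fun x => e (r * s * x))
  simp only [quadGauss]
  rw [h1, h2, ← Equiv.sum_comp (Equiv.mulLeft₀ r hr0) (fun y => (1 + (quadraticChar F y : ℂ)) * e (s * y)),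
    ← sum_add_distrib]
  have h3 : ∀ x : F, (1 + (quadraticChar F x : ℂ)) * e (r * s * x) +
      (1 + (quadraticChar F ((Equiv.mulLeft₀ r hr0) x) : ℂ)) * e (s * (Equiv.mulLeft₀ r hr0) x)
      = 2 * e (x * (r * s)) := fun x => by
    have h4 : s * (r * x) = x * (r * s) := by ring
    have h5 : r * s * x = x * (r * s) := by ring
    simp only [hmul, map_mul, hχ, h4, h5]
    push_cast; ring
  simp_rw [h3, ← mul_sum, sum_addChar_mul he]
  simp [hr0, hs]

theorem sum_quadGauss_pow_five (hF : ringChar F ≠ 2) {e : AddChar F ℂ} (he : e ≠ 1) :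
    ∑ s : F, (if s = 0 then 0 else quadGauss e s ^ 5) = 0 := by
  obtain ⟨r, hr⟩ := FiniteField.exists_nonsquare hF
  have hr0 : r ≠ 0 := by rintro rfl; exact hr (by simp)
  have hmul : ∀ x, Equiv.mulLeft₀ r hr0 x = r * x := fun _ => rfl
  rw [← self_eq_neg, ← sum_neg_distrib]
  rw [← Equiv.sum_comp (Equiv.mulLeft₀ r hr0)]
  refine sum_congr rfl fun s _ => ?_
  by_cases hs : s = 0
  · simp [hs]
  · simp only [hmul, mul_eq_zero, hr0, hs, or_self, if_false]
    rw [quadGauss_mul_nonsquare hF he hr hs]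
    ring

omit [DecidableEq F] in
theorem sum_addChar_quadratic (hF : ringChar F ≠ 2) (e : AddChar F ℂ) {n : ℕ} {s : F}
    (hs : s ≠ 0) (w : Fin n → F) :
    ∑ b : Fin n → F, e (s * (b ⬝ᵥ b) + w ⬝ᵥ b) =
      e (-(w ⬝ᵥ w) / (4 * s)) * quadGauss e s ^ n := by
  have h2 : (2 : F) ≠ 0 := Ring.two_ne_zero hF
  have h4 : (4 : F) ≠ 0 := by
    have : (4 : F) = 2 * 2 := by norm_num
    rw [this]; exact mul_ne_zero h2 h2
  have h0 : ∑ b : Fin n → F, e (s * (b ⬝ᵥ b)) = quadGauss e s ^ n := by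
    have h : ∀ b : Fin n → F, e (s * (b ⬝ᵥ b)) = ∏ i, e (s * (b i * b i)) := fun u => by
      simp only [dotProduct, mul_sum]
      exact map_sum_addChar e _
    simp_rw [h]
    have h2 := Finset.prod_univ_sum (fun _ : Fin n => (univ : Finset F))
      (fun _ x => e (s * (x * x)))
    rw [Fintype.piFinset_univ] at h2
    rw [← h2]
    simp [quadGauss]
  rw [← h0, mul_sum, ← Equiv.sum_comp (Equiv.addRight ((-(2 * s)⁻¹) • w))]
  refine sum_congr rfl fun b _ => ?_
  rw [← AddChar.map_add_eq_mul, Equiv.coe_addRight]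
  congr 1
  simp only [add_dotProduct, dotProduct_add, smul_dotProduct, dotProduct_smul, smul_eq_mul]
  rw [dotProduct_comm w b]
  field_simp
  ring

end CharacterSums

section Counting

variable {F : Type} [Field F] [Fintype F] [DecidableEq F]

theorem card_mul_ite_eq_zero {e : AddChar F ℂ} (he : e ≠ 1) (a : F) :
    (Fintype.card F : ℂ) * (if a = 0 then 1 else 0) = ∑ x, e (x * a) := by
  rw [sum_addChar_mul he]; simp

theorem card_hyperplane {e : AddChar F ℂ} (he : e ≠ 1) {u : Fin 5 → F} (hu : u ≠ 0) (k : F) :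
    #{b : Fin 5 → F | u ⬝ᵥ b = k} = Fintype.card F ^ 4 := by
  have hq : (Fintype.card F : ℂ) ≠ 0 := by simp
  have h : (Fintype.card F : ℂ) * #{b : Fin 5 → F | u ⬝ᵥ b = k} = Fintype.card F ^ 5 := by
    calc (Fintype.card F : ℂ) * #{b : Fin 5 → F | u ⬝ᵥ b = k}
        = ∑ b : Fin 5 → F, ∑ s, e (s * (u ⬝ᵥ b - k)) := by
          rw [card_filter]
          push_cast
          rw [mul_sum]
          refine sum_congr rfl fun b _ => ?_
          rw [← card_mul_ite_eq_zero he]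
          simp only [sub_eq_zero]
      _ = ∑ s, e (-(s * k)) * ∑ b : Fin 5 → F, e (b ⬝ᵥ (s • u)) := by
          rw [sum_comm]
          refine sum_congr rfl fun s _ => ?_
          rw [mul_sum]
          refine sum_congr rfl fun b _ => ?_
          rw [← AddChar.map_add_eq_mul, dotProduct_smul, dotProduct_comm, smul_eq_mul]
          congr 1; ring
      _ = Fintype.card F ^ 5 := by
          simp_rw [sum_addChar_dotProduct he, smul_eq_zero]
          simp [hu]
  have h2 : (#{b : Fin 5 → F | u ⬝ᵥ b = k} : ℂ) = (Fintype.card F : ℂ) ^ 4 := by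
    apply mul_left_cancel₀ hq
    rw [h]; ring
  exact_mod_cast h2

theorem card_hyperplane_inter {e : AddChar F ℂ} (he : e ≠ 1) {u u' : Fin 5 → F}
    (hu : ∀ s t : F, s • u + t • u' = 0 → s = 0 ∧ t = 0) (k k' : F) :
    #{b : Fin 5 → F | u ⬝ᵥ b = k ∧ u' ⬝ᵥ b = k'} = Fintype.card F ^ 3 := by
  have hq : (Fintype.card F : ℂ) ≠ 0 := by simp
  have h : (Fintype.card F : ℂ) ^ 2 * #{b : Fin 5 → F | u ⬝ᵥ b = k ∧ u' ⬝ᵥ b = k'} =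
      Fintype.card F ^ 5 := by
    calc (Fintype.card F : ℂ) ^ 2 * #{b : Fin 5 → F | u ⬝ᵥ b = k ∧ u' ⬝ᵥ b = k'}
        = ∑ b : Fin 5 → F, ∑ s, ∑ t, e (s * (u ⬝ᵥ b - k)) * e (t * (u' ⬝ᵥ b - k')) := by
          rw [card_filter]
          push_cast
          rw [mul_sum]
          refine sum_congr rfl fun b _ => ?_
          rw [← sum_mul_sum, ← card_mul_ite_eq_zero he, ← card_mul_ite_eq_zero he]
          simp only [sub_eq_zero, ite_and]
          split_ifs <;> ring
      _ = ∑ s, ∑ t, e (-(s * k) - t * k') *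
            ∑ b : Fin 5 → F, e (b ⬝ᵥ (s • u + t • u')) := by
          rw [sum_comm]
          refine sum_congr rfl fun s _ => ?_
          rw [sum_comm]
          refine sum_congr rfl fun t _ => ?_
          rw [mul_sum]
          refine sum_congr rfl fun b _ => ?_
          rw [← AddChar.map_add_eq_mul, ← AddChar.map_add_eq_mul, dotProduct_add,
            dotProduct_smul, dotProduct_smul, dotProduct_comm b, dotProduct_comm b,
            smul_eq_mul, smul_eq_mul]
          congr 1; ring
      _ = Fintype.card F ^ 5 := by
          have h1 : ∀ s t : F, s • u + t • u' = 0 ↔ s = 0 ∧ t = 0 := fun s t =>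
            ⟨hu s t, by rintro ⟨rfl, rfl⟩; simp⟩
          simp_rw [sum_addChar_dotProduct he, h1, ite_and]
          simp
  have h2 : (#{b : Fin 5 → F | u ⬝ᵥ b = k ∧ u' ⬝ᵥ b = k'} : ℂ) = (Fintype.card F : ℂ) ^ 3 := by
    apply mul_left_cancel₀ (pow_ne_zero 2 hq)
    rw [h]; ring
  exact_mod_cast h2

/-- In `F^5`, the number of isotropic vectors orthogonal to two isotropic vectors `u, u'` depends
only on the number of linear relations between them. -/
theorem card_isotropic (hF : ringChar F ≠ 2) {e : AddChar F ℂ} (he : e ≠ 1) {u u' : Fin 5 → F}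
    (hu : u ⬝ᵥ u = 0) (hu' : u' ⬝ᵥ u' = 0) :
    #{b : Fin 5 → F | b ⬝ᵥ b = 0 ∧ u ⬝ᵥ b = 0 ∧ u' ⬝ᵥ b = 0} =
      Fintype.card F ^ 2 * #{p : F × F | p.1 • u + p.2 • u' = 0} := by
  have hq : (Fintype.card F : ℂ) ≠ 0 := by simp
  have h : (Fintype.card F : ℂ) ^ 3 *
      #{b : Fin 5 → F | b ⬝ᵥ b = 0 ∧ u ⬝ᵥ b = 0 ∧ u' ⬝ᵥ b = 0} =
      Fintype.card F ^ 5 * #{p : F × F | p.1 • u + p.2 • u' = 0} := by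
    calc (Fintype.card F : ℂ) ^ 3 *
          #{b : Fin 5 → F | b ⬝ᵥ b = 0 ∧ u ⬝ᵥ b = 0 ∧ u' ⬝ᵥ b = 0}
        = ∑ b : Fin 5 → F, ∑ s, e (s * (b ⬝ᵥ b)) *
            (∑ t, ∑ t', e (t * (u ⬝ᵥ b)) * e (t' * (u' ⬝ᵥ b))) := by
          rw [card_filter]
          push_cast
          rw [mul_sum]
          refine sum_congr rfl fun b _ => ?_
          rw [← sum_mul, ← sum_mul_sum]
          simp_rw [← card_mul_ite_eq_zero he, ite_and]
          split_ifs <;> ring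
      _ = ∑ s, ∑ p : F × F, ∑ b : Fin 5 → F,
            e (s * (b ⬝ᵥ b) + (p.1 • u + p.2 • u') ⬝ᵥ b) := by
          rw [sum_comm]
          refine sum_congr rfl fun s _ => ?_
          rw [sum_comm]
          refine sum_congr rfl fun b _ => ?_
          rw [Fintype.sum_prod_type, mul_sum]
          refine sum_congr rfl fun t _ => ?_
          rw [mul_sum]
          refine sum_congr rfl fun t' _ => ?_
          rw [← AddChar.map_add_eq_mul, ← AddChar.map_add_eq_mul, add_dotProduct,
            smul_dotProduct, smul_dotProduct, smul_eq_mul, smul_eq_mul]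
      _ = (∑ p : F × F, ∑ b : Fin 5 → F, e ((p.1 • u + p.2 • u') ⬝ᵥ b)) +
            ∑ s, (if s = 0 then 0 else quadGauss e s ^ 5) *
              ∑ p : F × F, e (-(2 * (p.1 * p.2 * (u ⬝ᵥ u'))) / 4) := by
          rw [← add_sum_erase _ _ (mem_univ (0 : F))]
          congr 1
          · simp
          · rw [← add_sum_erase _ _ (mem_univ (0 : F))]
            simp only [if_true, zero_mul, zero_add]
            refine sum_congr rfl fun s hs => ?_
            have hs0 : s ≠ 0 := (mem_erase.mp hs).1
            simp_rw [sum_addChar_quadratic hF e hs0]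
            rw [← sum_mul, mul_comm, if_neg hs0]
            congr 1
            rw [Fintype.sum_prod_type, Fintype.sum_prod_type,
              ← Equiv.sum_comp (Equiv.mulLeft₀ s hs0)]
            refine sum_congr rfl fun t _ => sum_congr rfl fun t' _ => ?_
            have hmul : ∀ x, Equiv.mulLeft₀ s hs0 x = s * x := fun _ => rfl
            congr 1
            simp only [hmul, add_dotProduct, dotProduct_add, smul_dotProduct, dotProduct_smul,
              smul_eq_mul, hu, hu', dotProduct_comm u' u]
            field_simp
            ring
      _ = Fintype.card F ^ 5 * #{p : F × F | p.1 • u + p.2 • u' = 0} := by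
          rw [← sum_mul, sum_quadGauss_pow_five hF he]
          simp_rw [dotProduct_comm (_ + _), sum_addChar_dotProduct he]
          rw [zero_mul, add_zero, ← sum_filter, sum_const, nsmul_eq_mul, mul_comm]
  have h2 : (#{b : Fin 5 → F | b ⬝ᵥ b = 0 ∧ u ⬝ᵥ b = 0 ∧ u' ⬝ᵥ b = 0} : ℂ) =
      (Fintype.card F : ℂ) ^ 2 * #{p : F × F | p.1 • u + p.2 • u' = 0} := by
    apply mul_left_cancel₀ (pow_ne_zero 3 hq)
    rw [h]; ring
  exact_mod_cast h2

end Counting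

section RightAngles

/-- Second moment method: a relation `R` of density `1 / q` between `X` and `B` whose second moment
is almost minimal is equidistributed on subsets of `B`. -/
theorem sum_card_filter_le_of_second_moment {α β : Type*} {X : Finset α} {Y B : Finset β}
    (hY : Y ⊆ B) (R : α → β → Prop) [∀ a b, Decidable (R a b)] {q : ℝ} (hq : 0 < q)
    (h1 : ∀ c ∈ X, q * #{b ∈ B | R c b} = #B)
    (h2 : q ^ 2 * ∑ c ∈ X, ∑ c' ∈ X, (#{b ∈ B | R c b ∧ R c' b} : ℝ) ≤
      (#X : ℝ) ^ 2 * #B + q ^ 6 * #X) :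
    ∑ c ∈ X, (#{b ∈ Y | R c b} : ℝ) ≤ #X * #Y / q + q ^ 2 * (#X + #Y) / 2 := by
  set w : β → ℝ := fun b => ∑ c ∈ X, if R c b then 1 else 0 with hw
  have hsum : ∀ Z : Finset β, ∑ b ∈ Z, w b = ∑ c ∈ X, (#{b ∈ Z | R c b} : ℝ) := fun Z => by
    rw [hw, sum_comm]
    refine sum_congr rfl fun c _ => ?_
    rw [card_filter]; push_cast; rfl
  have hsq : ∑ b ∈ B, w b ^ 2 = ∑ c ∈ X, ∑ c' ∈ X, (#{b ∈ B | R c b ∧ R c' b} : ℝ) := by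
    simp only [hw, sq, sum_mul_sum]
    rw [sum_comm]
    refine sum_congr rfl fun c _ => ?_
    rw [sum_comm]
    refine sum_congr rfl fun c' _ => ?_
    rw [card_filter]; push_cast
    refine sum_congr rfl fun b _ => ?_
    rw [ite_and]
    split_ifs <;> simp
  have hB : q * ∑ b ∈ B, w b = #X * #B := by
    rw [hsum, mul_sum, sum_congr rfl h1]; simp
  have hvar : ∑ b ∈ B, (q * w b - #X) ^ 2 ≤ q ^ 6 * #X := by
    have : ∑ b ∈ B, (q * w b - #X) ^ 2 =
        q ^ 2 * ∑ b ∈ B, w b ^ 2 - 2 * #X * (q * ∑ b ∈ B, w b) + #B * (#X : ℝ) ^ 2 := by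
      rw [mul_sum, mul_sum, mul_sum, ← nsmul_eq_mul, ← sum_const, ← sum_sub_distrib,
        ← sum_add_distrib]
      exact sum_congr rfl fun b _ => by ring
    rw [this, hB, hsq]
    linarith
  have hvarY : ∑ b ∈ Y, (q * w b - #X) ^ 2 ≤ q ^ 6 * #X :=
    (sum_le_sum_of_subset_of_nonneg hY fun _ _ _ => sq_nonneg _).trans hvar
  rw [← hsum]
  calc ∑ b ∈ Y, w b ≤ ∑ b ∈ Y, (#X / q + q ^ 2 / 2 + (q * w b - #X) ^ 2 / (2 * q ^ 4)) := by
        refine sum_le_sum fun b _ => ?_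
        have : #X / q + q ^ 2 / 2 + (q * w b - #X) ^ 2 / (2 * q ^ 4) - w b =
            (q * w b - #X - q ^ 3) ^ 2 / (2 * q ^ 4) := by
          field_simp
          ring
        have h0 : 0 ≤ (q * w b - #X - q ^ 3) ^ 2 / (2 * q ^ 4) := by positivity
        linarith
    _ = #X * #Y / q + q ^ 2 * #Y / 2 + (∑ b ∈ Y, (q * w b - #X) ^ 2) / (2 * q ^ 4) := by
        rw [sum_add_distrib, sum_const, sum_div, nsmul_eq_mul]
        ring
    _ ≤ #X * #Y / q + q ^ 2 * #Y / 2 + (q ^ 6 * #X) / (2 * q ^ 4) := by gcongr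
    _ = #X * #Y / q + q ^ 2 * (#X + #Y) / 2 := by
        field_simp
        ring

variable {F : Type} [Field F] [Fintype F] [DecidableEq F]

theorem card_right_angles_anisotropic_le {e : AddChar F ℂ} (he : e ≠ 1)
    (A : Finset (Fin 5 → F)) (a : Fin 5 → F) :
    ∑ c ∈ A with (a - c) ⬝ᵥ (a - c) ≠ 0, (#{b ∈ A | (a - c) ⬝ᵥ (b - c) = 0} : ℝ) ≤
      (#A : ℝ) ^ 2 / Fintype.card F + (Fintype.card F : ℝ) ^ 2 * #A := by
  set q : ℝ := (Fintype.card F : ℝ) with hq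
  have hq0 : 0 < q := by rw [hq]; exact_mod_cast Fintype.card_pos
  set X : Finset (Fin 5 → F) := {c ∈ A | (a - c) ⬝ᵥ (a - c) ≠ 0} with hX
  have hXA : (#X : ℝ) ≤ #A := by exact_mod_cast card_le_card (filter_subset _ _)
  have hX0 : ∀ c ∈ X, (a - c) ⬝ᵥ (a - c) ≠ 0 := fun c hc => (mem_filter.mp hc).2
  have hX1 : ∀ c ∈ X, a - c ≠ 0 := fun c hc h => hX0 c hc (by simp [h])
  have hB : (#(univ : Finset (Fin 5 → F)) : ℝ) = q ^ 5 := by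
    rw [card_univ]; simp [hq]
  have key := sum_card_filter_le_of_second_moment (X := X) (subset_univ A)
    (fun c b => (a - c) ⬝ᵥ (b - c) = 0) hq0 ?_ ?_
  · refine key.trans ?_
    have h : (#X : ℝ) * #A ≤ (#A : ℝ) ^ 2 := by rw [sq]; gcongr
    gcongr
    nlinarith [sq_nonneg q]
  · intro c hc
    rw [hB]
    simp_rw [dotProduct_sub (a - c), sub_eq_zero]
    rw [card_hyperplane he (hX1 c hc)]
    push_cast
    rw [← hq]; ring
  · have hpair : ∀ c ∈ X, ∀ c' ∈ X,
        (#{b : Fin 5 → F | (a - c) ⬝ᵥ (b - c) = 0 ∧ (a - c') ⬝ᵥ (b - c') = 0} : ℝ) ≤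
          q ^ 3 + if c = c' then q ^ 4 else 0 := by
      intro c hc c' hc'
      split_ifs with hcc
      · subst hcc
        simp_rw [and_self, dotProduct_sub (a - c), sub_eq_zero]
        rw [card_hyperplane he (hX1 c hc)]
        push_cast
        rw [← hq]
        have : 0 ≤ q ^ 3 := by positivity
        linarith
      · by_cases hli : ∀ s t : F, s • (a - c) + t • (a - c') = 0 → s = 0 ∧ t = 0
        · simp_rw [dotProduct_sub (a - c), dotProduct_sub (a - c'), sub_eq_zero]
          rw [card_hyperplane_inter he hli]
          push_cast
          rw [← hq, add_zero]
        · have hdep : ∃ r : F, a - c' = r • (a - c) := by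
            push Not at hli
            obtain ⟨s, t, hst, h0⟩ := hli
            have ht : t ≠ 0 := by
              intro ht
              rw [ht, zero_smul, add_zero, smul_eq_zero] at hst
              exact h0 (hst.resolve_right (hX1 c hc)) ht
            refine ⟨-(t⁻¹ * s), ?_⟩
            have : t⁻¹ • (s • (a - c) + t • (a - c')) = 0 := by rw [hst, smul_zero]
            rw [smul_add, smul_smul, smul_smul, inv_mul_cancel₀ ht, one_smul] at this
            rw [neg_smul]
            exact eq_neg_of_add_eq_zero_right this
          obtain ⟨r, hr⟩ := hdep
          have hempty : ({b : Fin 5 → F | (a - c) ⬝ᵥ (b - c) = 0 ∧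
              (a - c') ⬝ᵥ (b - c') = 0} : Finset _) = ∅ := by
            rw [filter_eq_empty_iff]
            rintro b - ⟨h1, h2⟩
            have hc1 : b - c' = (b - c) - (1 - r) • (a - c) := by
              rw [sub_smul, one_smul, ← hr]; abel
            rw [hr, hc1, smul_dotProduct, dotProduct_sub, h1, dotProduct_smul, smul_eq_mul,
              smul_eq_mul, zero_sub, mul_neg, neg_eq_zero, mul_eq_zero, mul_eq_zero] at h2
            rcases h2 with h | h | h
            · exact hX1 c' hc' (by rw [hr, h, zero_smul])
            · apply hcc
              rw [← sub_eq_zero.mp h, one_smul] at hr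
              exact (sub_right_inj.mp hr).symm
            · exact hX0 c hc h
          rw [hempty]
          simp only [card_empty, Nat.cast_zero]
          positivity
    calc q ^ 2 * ∑ c ∈ X, ∑ c' ∈ X,
          (#{b : Fin 5 → F | (a - c) ⬝ᵥ (b - c) = 0 ∧ (a - c') ⬝ᵥ (b - c') = 0} : ℝ)
        ≤ q ^ 2 * ∑ c ∈ X, ∑ c' ∈ X, (q ^ 3 + if c = c' then q ^ 4 else 0) := by
          gcongr with c hc c' hc'
          exact hpair c hc c' hc'
      _ = (#X : ℝ) ^ 2 * #(univ : Finset (Fin 5 → F)) + q ^ 6 * #X := by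
          rw [hB]
          simp only [sum_add_distrib, sum_const, sum_ite_eq, nsmul_eq_mul]
          rw [← sum_filter, filter_mem_eq_inter, inter_self, sum_const, nsmul_eq_mul]
          ring
      _ ≤ _ := le_rfl

theorem card_linear_relations_le {u u' : Fin 5 → F} (hu : u ≠ 0) (hu' : u' ≠ 0) :
    #{p : F × F | p.1 • u + p.2 • u' = 0} ≤
      1 + #{t : F | u' = t • u} * Fintype.card F := by
  by_cases hdep : ∃ t : F, u' = t • u
  · obtain ⟨t, ht⟩ := hdep
    have h1 : 1 ≤ #{t : F | u' = t • u} := card_pos.mpr ⟨t, by simp [← ht]⟩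
    have h2 : #{p : F × F | p.1 • u + p.2 • u' = 0} ≤ Fintype.card F := by
      refine card_le_card_of_injOn Prod.fst (fun _ _ => mem_univ _) ?_
      rintro ⟨x, y⟩ hp ⟨x', y'⟩ hp' hxx
      simp only [coe_filter, mem_univ, true_and, Set.mem_ofPred_eq] at hp hp' hxx
      subst hxx
      have : (y - y') • u' = 0 := by
        rw [sub_smul, sub_eq_zero]
        exact add_left_cancel (hp.trans hp'.symm)
      rw [(sub_eq_zero.mp ((smul_eq_zero.mp this).resolve_right hu'))]
    nlinarith
  · have h2 : #{p : F × F | p.1 • u + p.2 • u' = 0} ≤ #{(0 : F × F)} := by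
      refine card_le_card ?_
      rintro ⟨x, y⟩ hp
      simp only [mem_filter, mem_univ, true_and] at hp
      have hy : y = 0 := by
        by_contra hy
        refine hdep ⟨-(y⁻¹ * x), ?_⟩
        have : y⁻¹ • (x • u + y • u') = 0 := by rw [hp, smul_zero]
        rw [smul_add, smul_smul, smul_smul, inv_mul_cancel₀ hy, one_smul] at this
        rw [neg_smul]
        exact eq_neg_of_add_eq_zero_right this
      rw [hy, zero_smul, add_zero, smul_eq_zero] at hp
      simp [hy, hp.resolve_right hu]
    rw [card_singleton] at h2
    exact h2.trans (Nat.le_add_right _ _)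

theorem card_right_angles_isotropic_le (hF : ringChar F ≠ 2) {e : AddChar F ℂ} (he : e ≠ 1)
    (A : Finset (Fin 5 → F)) (c : Fin 5 → F) :
    ∑ a ∈ A with (a - c) ⬝ᵥ (a - c) = 0 ∧ a ≠ c,
      (#{b ∈ A | (b - c) ⬝ᵥ (b - c) = 0 ∧ (a - c) ⬝ᵥ (b - c) = 0} : ℝ) ≤
      (#A : ℝ) ^ 2 / Fintype.card F + (Fintype.card F : ℝ) ^ 2 * #A := by
  set q : ℝ := (Fintype.card F : ℝ) with hq
  have hq0 : 0 < q := by rw [hq]; exact_mod_cast Fintype.card_pos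
  set X : Finset (Fin 5 → F) := {a ∈ A | (a - c) ⬝ᵥ (a - c) = 0 ∧ a ≠ c} with hX
  set Y : Finset (Fin 5 → F) := {b ∈ A | (b - c) ⬝ᵥ (b - c) = 0} with hY
  set B : Finset (Fin 5 → F) := {b | (b - c) ⬝ᵥ (b - c) = 0} with hB
  have hXA : (#X : ℝ) ≤ #A := by exact_mod_cast card_le_card (filter_subset _ _)
  have hYA : (#Y : ℝ) ≤ #A := by exact_mod_cast card_le_card (filter_subset _ _)
  have hX0 : ∀ a ∈ X, (a - c) ⬝ᵥ (a - c) = 0 := fun a ha => (mem_filter.mp ha).2.1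
  have hX1 : ∀ a ∈ X, a - c ≠ 0 := fun a ha => sub_ne_zero.mpr (mem_filter.mp ha).2.2
  have hcount : ∀ u u' : Fin 5 → F, u ⬝ᵥ u = 0 → u' ⬝ᵥ u' = 0 →
      #{b ∈ B | u ⬝ᵥ (b - c) = 0 ∧ u' ⬝ᵥ (b - c) = 0} =
        Fintype.card F ^ 2 * #{p : F × F | p.1 • u + p.2 • u' = 0} := by
    intro u u' hu hu'
    rw [← card_isotropic hF he hu hu', hB, filter_filter]
    refine card_equiv (Equiv.subRight c) fun b => ?_
    simp
  have hself : ∀ u : Fin 5 → F, u ≠ 0 → #{p : F × F | p.1 • u + p.2 • u = 0} = Fintype.card F := by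
    intro u hu
    rw [← card_univ (α := F)]
    refine card_bij' (fun p _ => p.1) (fun x _ => (x, -x)) (by simp) (by simp) ?_ (by simp)
    rintro ⟨x, y⟩ hp
    simp only [mem_filter, mem_univ, true_and, ← add_smul, smul_eq_zero, hu, or_false] at hp
    simp [eq_neg_of_add_eq_zero_right hp]
  have hBcard : (#B : ℝ) = q ^ 4 := by
    have := hcount 0 0 (by simp) (by simp)
    simp only [zero_dotProduct, and_self, filter_true, smul_zero, add_zero] at this
    rw [this, card_univ, Fintype.card_prod]
    push_cast
    rw [← hq]; ring
  have key := sum_card_filter_le_of_second_moment (X := X) (Y := Y) (B := B)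
    (filter_subset_filter _ (subset_univ _)) (fun a b => (a - c) ⬝ᵥ (b - c) = 0) hq0 ?_ ?_
  · have hfil : ∀ a, ({b ∈ A | (b - c) ⬝ᵥ (b - c) = 0 ∧ (a - c) ⬝ᵥ (b - c) = 0} : Finset _) =
        {b ∈ Y | (a - c) ⬝ᵥ (b - c) = 0} := fun a => by rw [hY, filter_filter]
    simp_rw [hfil]
    refine key.trans ?_
    have h : (#X : ℝ) * #Y ≤ (#A : ℝ) ^ 2 := by rw [sq]; gcongr
    gcongr
    nlinarith [sq_nonneg q]
  · intro a ha
    have := hcount _ _ (hX0 a ha) (hX0 a ha)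
    simp only [and_self] at this
    rw [this, hself _ (hX1 a ha), hBcard]
    push_cast
    rw [← hq]; ring
  · have hline : ∀ a ∈ X, ∑ a' ∈ X, (#{t : F | a' - c = t • (a - c)} : ℝ) ≤ q := by
      intro a _
      have h1 : ∑ a' ∈ X, #{t : F | a' - c = t • (a - c)} ≤ Fintype.card F := by
        rw [← card_sigma, ← card_univ (α := F)]
        refine card_le_card_of_injOn (fun x => x.2) (fun _ _ => mem_univ _) ?_
        rintro ⟨x, t⟩ hx ⟨x', t'⟩ hx' htt
        simp only [coe_sigma, Set.mem_sigma_iff, mem_coe, mem_filter, mem_univ, true_and]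
          at hx hx' htt
        subst htt
        have : x = x' := sub_left_inj.mp (hx.2.trans hx'.2.symm)
        rw [this]
      rw [hq]
      exact_mod_cast h1
    calc q ^ 2 * ∑ a ∈ X, ∑ a' ∈ X,
          (#{b ∈ B | (a - c) ⬝ᵥ (b - c) = 0 ∧ (a' - c) ⬝ᵥ (b - c) = 0} : ℝ)
        ≤ q ^ 2 * ∑ a ∈ X, ∑ a' ∈ X,
            q ^ 2 * (1 + #{t : F | a' - c = t • (a - c)} * q) := by
          gcongr with a ha a' ha'
          rw [hcount _ _ (hX0 a ha) (hX0 a' ha')]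
          push_cast
          rw [← hq]
          gcongr
          rw [hq]
          exact_mod_cast card_linear_relations_le (hX1 a ha) (hX1 a' ha')
      _ = q ^ 4 * ∑ a ∈ X, (#X + q * ∑ a' ∈ X, (#{t : F | a' - c = t • (a - c)} : ℝ)) := by
          simp only [← mul_sum, sum_add_distrib, ← sum_mul]
          simp
          ring
      _ ≤ q ^ 4 * ∑ a ∈ X, (#X + q * q) := by
          gcongr with a ha
          exact hline a ha
      _ = (#X : ℝ) ^ 2 * #B + q ^ 6 * #X := by
          rw [hBcard, sum_const, nsmul_eq_mul]
          ring

/-- The number of triples in `A` with a right angle at the third point. -/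
noncomputable def rightAngles (A : Finset (Fin 5 → F)) : ℝ :=
  ∑ a ∈ A, ∑ b ∈ A, ∑ c ∈ A, if (a - c) ⬝ᵥ (b - c) = 0 then 1 else 0

theorem rightAngles_le (hF : ringChar F ≠ 2) {e : AddChar F ℂ} (he : e ≠ 1)
    (A : Finset (Fin 5 → F)) :
    rightAngles A ≤ 3 * (#A : ℝ) ^ 3 / Fintype.card F +
      4 * (Fintype.card F : ℝ) ^ 2 * (#A : ℝ) ^ 2 := by
  set q : ℝ := (Fintype.card F : ℝ) with hq
  have hq1 : 1 ≤ q := by rw [hq]; exact_mod_cast Fintype.card_pos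
  set N : (Fin 5 → F) → ℝ := fun a =>
    ∑ c ∈ A with (a - c) ⬝ᵥ (a - c) ≠ 0, (#{b ∈ A | (a - c) ⬝ᵥ (b - c) = 0} : ℝ) with hN
  set M : (Fin 5 → F) → ℝ := fun c =>
    ∑ a ∈ A with (a - c) ⬝ᵥ (a - c) = 0 ∧ a ≠ c,
      (#{b ∈ A | (b - c) ⬝ᵥ (b - c) = 0 ∧ (a - c) ⬝ᵥ (b - c) = 0} : ℝ) with hM
  have hN' : ∀ a, N a = ∑ c ∈ A, ∑ b ∈ A,
      if (a - c) ⬝ᵥ (a - c) ≠ 0 ∧ (a - c) ⬝ᵥ (b - c) = 0 then 1 else 0 := fun a => by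
    simp only [hN]
    rw [sum_filter]
    refine sum_congr rfl fun c _ => ?_
    rw [card_filter]
    push_cast
    split_ifs with h
    · simp only [ne_eq] at h
      simp only [ne_eq, h, not_false_eq_true, true_and]
    · simp only [h, false_and, if_false, sum_const_zero]
  have hM' : ∀ c, M c = ∑ a ∈ A, ∑ b ∈ A,
      if ((a - c) ⬝ᵥ (a - c) = 0 ∧ a ≠ c) ∧ (b - c) ⬝ᵥ (b - c) = 0 ∧ (a - c) ⬝ᵥ (b - c) = 0
        then 1 else 0 := fun a => by
    simp only [hM]
    rw [sum_filter]
    refine sum_congr rfl fun c _ => ?_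
    rw [card_filter]
    push_cast
    split_ifs with h
    · simp only [h, true_and, ne_eq, not_false_eq_true, and_self]
    · simp only [h, false_and, if_false, sum_const_zero]
  have hsplit : rightAngles A ≤
      ∑ a ∈ A, N a + ∑ b ∈ A, N b + ∑ c ∈ A, M c + (#A : ℝ) ^ 2 := by
    have e1 : ∑ a ∈ A, N a = ∑ a ∈ A, ∑ b ∈ A, ∑ c ∈ A,
        if (a - c) ⬝ᵥ (a - c) ≠ 0 ∧ (a - c) ⬝ᵥ (b - c) = 0 then 1 else 0 := by
      simp_rw [hN']
      exact sum_congr rfl fun a _ => sum_comm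
    have e2 : ∑ b ∈ A, N b = ∑ a ∈ A, ∑ b ∈ A, ∑ c ∈ A,
        if (b - c) ⬝ᵥ (b - c) ≠ 0 ∧ (b - c) ⬝ᵥ (a - c) = 0 then 1 else 0 := by
      rw [e1, sum_comm]
    have e3 : ∑ c ∈ A, M c = ∑ a ∈ A, ∑ b ∈ A, ∑ c ∈ A,
        if ((a - c) ⬝ᵥ (a - c) = 0 ∧ a ≠ c) ∧ (b - c) ⬝ᵥ (b - c) = 0 ∧ (a - c) ⬝ᵥ (b - c) = 0
          then 1 else 0 := by
      simp_rw [hM']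
      rw [sum_comm]
      exact sum_congr rfl fun a _ => sum_comm
    have e4 : (#A : ℝ) ^ 2 = ∑ a ∈ A, ∑ b ∈ A, ∑ c ∈ A, if a = c then 1 else 0 := by
      simp [sq]
    nth_rewrite 1 [e1]
    rw [e2, e3, e4, rightAngles]
    simp only [← sum_add_distrib]
    refine sum_le_sum fun a _ => sum_le_sum fun b _ => sum_le_sum fun c _ => ?_
    rw [dotProduct_comm (b - c) (a - c)]
    by_cases h0 : (a - c) ⬝ᵥ (b - c) = 0 <;> by_cases h1 : (a - c) ⬝ᵥ (a - c) = 0 <;>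
      by_cases h2 : (b - c) ⬝ᵥ (b - c) = 0 <;> by_cases h3 : a = c <;>
      simp only [h0, h1, h2, h3, ne_eq, not_true_eq_false, not_false_eq_true, and_true,
        and_false, if_true, if_false, false_and, true_and] <;> norm_num
  have hNle : ∑ a ∈ A, N a ≤ #A * ((#A : ℝ) ^ 2 / q + q ^ 2 * #A) := by
    rw [← nsmul_eq_mul]
    exact sum_le_card_nsmul _ _ _ fun a _ => card_right_angles_anisotropic_le he A a
  have hMle : ∑ a ∈ A, M a ≤ #A * ((#A : ℝ) ^ 2 / q + q ^ 2 * #A) := by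
    rw [← nsmul_eq_mul]
    exact sum_le_card_nsmul _ _ _ fun a _ => card_right_angles_isotropic_le hF he A a
  have hlast : (#A : ℝ) ^ 2 ≤ q ^ 2 * (#A : ℝ) ^ 2 :=
    le_mul_of_one_le_left (sq_nonneg _) (one_le_pow₀ hq1)
  calc rightAngles A ≤ 3 * (#A * ((#A : ℝ) ^ 2 / q + q ^ 2 * #A)) + q ^ 2 * (#A : ℝ) ^ 2 := by
        linarith
    _ = _ := by ring

end RightAngles

section FourthMoment

variable {F : Type} [Field F] [Fintype F] [DecidableEq F]

theorem sum_addChar_paraboloid {e : AddChar F ℂ} (he : e ≠ 1) (v : Fin 5 → F) (s : F) :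
    ∑ p : (Fin 5 → F) × F, e (p.1 ⬝ᵥ v + p.2 * s) =
      if v = 0 ∧ s = 0 then (Fintype.card F : ℂ) ^ 6 else 0 := by
  rw [Fintype.sum_prod_type]
  simp_rw [AddChar.map_add_eq_mul]
  rw [← sum_mul_sum, sum_addChar_dotProduct he, sum_addChar_mul he, ite_and]
  split_ifs <;> ring

theorem sum_norm_extension_pow_four_le (hF : ringChar F ≠ 2) {e : AddChar F ℂ} (he : e ≠ 1)
    (A : Finset (Fin 5 → F)) {g : (Fin 5 → F) → ℂ} (hg : ∀ y, ‖g y‖ ≤ 1) :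
    ∑ p : (Fin 5 → F) × F, ‖∑ y ∈ A, g y * e (p.1 ⬝ᵥ y + p.2 * (y ⬝ᵥ y))‖ ^ 4 ≤
      (Fintype.card F : ℝ) ^ 6 * rightAngles A := by
  have h2 : (2 : F) ≠ 0 := Ring.two_ne_zero hF
  set T : (Fin 5 → F) × F → ℂ := fun p => ∑ y ∈ A, g y * e (p.1 ⬝ᵥ y + p.2 * (y ⬝ᵥ y)) with hT
  have hpow : ∀ z : ℂ, ((‖z‖ ^ 4 : ℝ) : ℂ) = z * (z * (conj z * conj z)) := fun z => by
    have : z * (z * (conj z * conj z)) = (z * conj z) ^ 2 := by ring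
    rw [this, Complex.mul_conj, Complex.normSq_eq_norm_sq]
    push_cast; ring
  have hexp : ∀ p, ((‖T p‖ ^ 4 : ℝ) : ℂ) = ∑ a ∈ A, ∑ b ∈ A, ∑ c ∈ A, ∑ d ∈ A,
      (g a * (g b * (conj (g c) * conj (g d)))) * e (p.1 ⬝ᵥ (a + b - c - d) +
        p.2 * (a ⬝ᵥ a + b ⬝ᵥ b - c ⬝ᵥ c - d ⬝ᵥ d)) := by
    intro p
    have hc : conj (T p) = ∑ y ∈ A, conj (g y) * e (-(p.1 ⬝ᵥ y + p.2 * (y ⬝ᵥ y))) := by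
      simp only [hT, map_sum, map_mul, AddChar.map_neg_eq_conj]
    rw [hpow, hc]
    have hterm : ∀ a b c d : Fin 5 → F,
        (g a * (g b * (conj (g c) * conj (g d)))) * e (p.1 ⬝ᵥ (a + b - c - d) +
          p.2 * (a ⬝ᵥ a + b ⬝ᵥ b - c ⬝ᵥ c - d ⬝ᵥ d)) =
        (g a * e (p.1 ⬝ᵥ a + p.2 * (a ⬝ᵥ a))) * ((g b * e (p.1 ⬝ᵥ b + p.2 * (b ⬝ᵥ b))) *
          ((conj (g c) * e (-(p.1 ⬝ᵥ c + p.2 * (c ⬝ᵥ c)))) *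
            (conj (g d) * e (-(p.1 ⬝ᵥ d + p.2 * (d ⬝ᵥ d)))))) := by
      intro a b c d
      have : p.1 ⬝ᵥ (a + b - c - d) + p.2 * (a ⬝ᵥ a + b ⬝ᵥ b - c ⬝ᵥ c - d ⬝ᵥ d) =
          (p.1 ⬝ᵥ a + p.2 * (a ⬝ᵥ a)) + (p.1 ⬝ᵥ b + p.2 * (b ⬝ᵥ b)) +
          -(p.1 ⬝ᵥ c + p.2 * (c ⬝ᵥ c)) + -(p.1 ⬝ᵥ d + p.2 * (d ⬝ᵥ d)) := by
        simp only [dotProduct_add, dotProduct_sub]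
        ring
      rw [this]
      simp only [AddChar.map_add_eq_mul e (_ + _ + _),
        AddChar.map_add_eq_mul e (p.1 ⬝ᵥ a + p.2 * (a ⬝ᵥ a))]
      ring
    simp_rw [hterm, ← mul_sum, ← sum_mul]
    rfl
  have htotal : ((∑ p, ‖T p‖ ^ 4 : ℝ) : ℂ) = ∑ a ∈ A, ∑ b ∈ A, ∑ c ∈ A, ∑ d ∈ A,
      (g a * (g b * (conj (g c) * conj (g d)))) *
        (if a + b - c - d = 0 ∧ a ⬝ᵥ a + b ⬝ᵥ b - c ⬝ᵥ c - d ⬝ᵥ d = 0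
          then (Fintype.card F : ℂ) ^ 6 else 0) := by
    rw [Complex.ofReal_sum]
    simp_rw [hexp, ← sum_addChar_paraboloid he, mul_sum]
    rw [sum_comm]
    refine sum_congr rfl fun a _ => ?_
    rw [sum_comm]
    refine sum_congr rfl fun b _ => ?_
    rw [sum_comm]
    refine sum_congr rfl fun c _ => ?_
    rw [sum_comm]
  have hnorm : ∑ p, ‖T p‖ ^ 4 = ‖((∑ p, ‖T p‖ ^ 4 : ℝ) : ℂ)‖ := by
    rw [Complex.norm_real, Real.norm_of_nonneg (sum_nonneg fun _ _ => by positivity)]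
  rw [hnorm, htotal, rightAngles, mul_sum]
  refine (norm_sum_le _ _).trans (sum_le_sum fun a _ => ?_)
  rw [mul_sum]
  refine (norm_sum_le _ _).trans (sum_le_sum fun b _ => ?_)
  rw [mul_sum]
  refine (norm_sum_le _ _).trans (sum_le_sum fun c _ => ?_)
  have hbound : ∀ d : Fin 5 → F, ‖(g a * (g b * (conj (g c) * conj (g d)))) *
        (if a + b - c - d = 0 ∧ a ⬝ᵥ a + b ⬝ᵥ b - c ⬝ᵥ c - d ⬝ᵥ d = 0
          then (Fintype.card F : ℂ) ^ 6 else 0)‖ ≤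
      if d = a + b - c then
        (Fintype.card F : ℝ) ^ 6 * (if (a - c) ⬝ᵥ (b - c) = 0 then 1 else 0) else 0 := by
    intro d
    by_cases hd : d = a + b - c
    · have hq : a ⬝ᵥ a + b ⬝ᵥ b - c ⬝ᵥ c - d ⬝ᵥ d = -2 * ((a - c) ⬝ᵥ (b - c)) := by
        rw [hd]
        simp only [dotProduct_add, dotProduct_sub, add_dotProduct, sub_dotProduct,
          dotProduct_comm b a, dotProduct_comm c a, dotProduct_comm c b]
        ring
      have h0 : a + b - c - d = 0 := by rw [hd, sub_self]
      have hgg : ‖g a * (g b * (conj (g c) * conj (g d)))‖ ≤ 1 := by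
        simp only [norm_mul, RCLike.norm_conj]
        have h4 : ‖g c‖ * ‖g d‖ ≤ 1 := mul_le_one₀ (hg c) (norm_nonneg _) (hg d)
        have h3 : ‖g b‖ * (‖g c‖ * ‖g d‖) ≤ 1 := mul_le_one₀ (hg b) (by positivity) h4
        exact mul_le_one₀ (hg a) (by positivity) h3
      rw [norm_mul, hq, if_pos hd]
      simp only [h0, true_and, mul_eq_zero, neg_eq_zero, h2, false_or]
      refine (mul_le_of_le_one_left (norm_nonneg _) hgg).trans ?_
      split_ifs <;> simp
    · have h0 : a + b - c - d ≠ 0 := fun h => hd (sub_eq_zero.mp h).symm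
      simp [h0, hd]
  refine (norm_sum_le _ _).trans ((sum_le_sum fun d _ => hbound d).trans ?_)
  rw [sum_ite_eq']
  split_ifs <;> simp

end FourthMoment

section Kernel

variable {F : Type} [Field F] [Fintype F]

/-- The Fourier transform `(dσ)^∨` of the surface measure on the paraboloid in `F^6`. -/
noncomputable def surfaceKernel (e : AddChar F ℂ) (v : Fin 5 → F) (τ : F) : ℂ :=
  ((Fintype.card F : ℂ) ^ 5)⁻¹ * ∑ b : Fin 5 → F, e (v ⬝ᵥ b + τ * (b ⬝ᵥ b))

theorem norm_sum_mul_surfaceKernel_pow_four (hF : ringChar F ≠ 2) {e : AddChar F ℂ}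
    (he : e ≠ 1) (A : Finset (Fin 5 → F)) (g : (Fin 5 → F) → ℂ) (x : Fin 5 → F) {τ : F}
    (hτ : τ ≠ 0) :
    ‖∑ y ∈ A, g y * surfaceKernel e (x - y) τ‖ ^ 4 = ((Fintype.card F : ℝ) ^ 10)⁻¹ *
      ‖∑ y ∈ A, g y * e (((2 * τ)⁻¹ • x) ⬝ᵥ y + (-(4 * τ)⁻¹) * (y ⬝ᵥ y))‖ ^ 4 := by
  have h2 : (2 : F) ≠ 0 := Ring.two_ne_zero hF
  have h4 : (4 : F) ≠ 0 := by
    have : (4 : F) = 2 * 2 := by norm_num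
    rw [this]; exact mul_ne_zero h2 h2
  have hq : (Fintype.card F : ℝ) ≠ 0 := by simp
  have hsum : ∑ y ∈ A, g y * surfaceKernel e (x - y) τ =
      (((Fintype.card F : ℂ) ^ 5)⁻¹ * quadGauss e τ ^ 5 * e (-(x ⬝ᵥ x) / (4 * τ))) *
        ∑ y ∈ A, g y * e (((2 * τ)⁻¹ • x) ⬝ᵥ y + (-(4 * τ)⁻¹) * (y ⬝ᵥ y)) := by
    rw [mul_sum]
    refine sum_congr rfl fun y _ => ?_
    have harg : -((x - y) ⬝ᵥ (x - y)) / (4 * τ) = -(x ⬝ᵥ x) / (4 * τ) +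
        (((2 * τ)⁻¹ • x) ⬝ᵥ y + (-(4 * τ)⁻¹) * (y ⬝ᵥ y)) := by
      simp only [dotProduct_sub, sub_dotProduct, smul_dotProduct, smul_eq_mul,
        dotProduct_comm y x]
      have : (2 * τ)⁻¹ = 2 * (4 * τ)⁻¹ := by
        field_simp
        norm_num
      rw [this]
      field_simp
      ring
    rw [surfaceKernel]
    simp_rw [add_comm ((x - y) ⬝ᵥ _)]
    rw [sum_addChar_quadratic hF e hτ, harg, AddChar.map_add_eq_mul]
    ring
  have hG : ‖quadGauss e τ‖ ^ 20 = (Fintype.card F : ℝ) ^ 10 := by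
    rw [← norm_quadGauss_sq hF he hτ, ← pow_mul]
  rw [hsum]
  simp only [norm_mul, norm_inv, norm_pow, Complex.norm_natCast, AddChar.norm_apply, mul_pow,
    ← pow_mul, inv_pow]
  norm_num [hG]
  field_simp
  exact Or.inl trivial

/-- The transform `ĝ` restricted to the paraboloid, of `g` supported on `E`. -/
noncomputable def paraboloidTransform (e : AddChar F ℂ) (E : Finset ((Fin 5 → F) × F))
    (g : (Fin 5 → F) × F → ℂ) (y : Fin 5 → F) : ℂ :=
  ∑ x ∈ E, g x * e (x.1 ⬝ᵥ y + x.2 * (y ⬝ᵥ y))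

theorem sum_norm_paraboloidTransform_sq (e : AddChar F ℂ) (E : Finset ((Fin 5 → F) × F))
    (g : (Fin 5 → F) × F → ℂ) :
    ((((Fintype.card F : ℝ) ^ 5)⁻¹ * ∑ y, ‖paraboloidTransform e E g y‖ ^ 2 : ℝ) : ℂ) =
      ∑ x ∈ E, ∑ x' ∈ E, g x * conj (g x') * surfaceKernel e (x.1 - x'.1) (x.2 - x'.2) := by
  have h : ∀ y, ((‖paraboloidTransform e E g y‖ ^ 2 : ℝ) : ℂ) =
      ∑ x ∈ E, ∑ x' ∈ E, g x * conj (g x') *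
        e ((x.1 - x'.1) ⬝ᵥ y + (x.2 - x'.2) * (y ⬝ᵥ y)) := by
    intro y
    rw [← Complex.normSq_eq_norm_sq, ← Complex.mul_conj, paraboloidTransform, map_sum,
      sum_mul_sum]
    refine sum_congr rfl fun x _ => sum_congr rfl fun x' _ => ?_
    have : (x.1 - x'.1) ⬝ᵥ y + (x.2 - x'.2) * (y ⬝ᵥ y) =
        (x.1 ⬝ᵥ y + x.2 * (y ⬝ᵥ y)) + -(x'.1 ⬝ᵥ y + x'.2 * (y ⬝ᵥ y)) := by
      rw [sub_dotProduct]; ring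
    rw [this, AddChar.map_add_eq_mul e _ (-_), AddChar.map_neg_eq_conj, map_mul (starRingEnd ℂ)]
    ring
  rw [Complex.ofReal_mul, Complex.ofReal_sum]
  simp_rw [h]
  rw [sum_comm, mul_sum]
  refine sum_congr rfl fun x _ => ?_
  rw [sum_comm, mul_sum]
  refine sum_congr rfl fun x' _ => ?_
  rw [← mul_sum, surfaceKernel]
  push_cast
  ring

variable [DecidableEq F]

theorem sum_norm_sum_mul_surfaceKernel_pow_four_le (hF : ringChar F ≠ 2) {e : AddChar F ℂ}
    (he : e ≠ 1) (A : Finset (Fin 5 → F)) {g : (Fin 5 → F) → ℂ} (hg : ∀ y, ‖g y‖ ≤ 1) :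
    ∑ p : (Fin 5 → F) × F with p.2 ≠ 0,
      ‖∑ y ∈ A, g y * surfaceKernel e (p.1 - y) p.2‖ ^ 4 ≤
        ((Fintype.card F : ℝ) ^ 4)⁻¹ * rightAngles A := by
  have h2 : (2 : F) ≠ 0 := Ring.two_ne_zero hF
  have h4 : (4 : F) ≠ 0 := by
    have : (4 : F) = 2 * 2 := by norm_num
    rw [this]; exact mul_ne_zero h2 h2
  have hq : (Fintype.card F : ℝ) ≠ 0 := by simp
  set Φ : (Fin 5 → F) × F → ℝ :=
    fun p => ‖∑ y ∈ A, g y * e (p.1 ⬝ᵥ y + p.2 * (y ⬝ᵥ y))‖ ^ 4 with hΦ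
  set φ : (Fin 5 → F) × F → (Fin 5 → F) × F :=
    fun p => ((2 * p.2)⁻¹ • p.1, -(4 * p.2)⁻¹) with hφ
  have hinj : Set.InjOn φ ({p | p.2 ≠ 0} : Finset ((Fin 5 → F) × F)) := by
    rintro ⟨x, s⟩ hx ⟨y, t⟩ hy hxy
    simp only [coe_filter, mem_univ, true_and, Set.mem_ofPred_eq] at hx hy
    simp only [hφ, Prod.mk.injEq, neg_inj, inv_inj] at hxy
    obtain ⟨h1, h3⟩ := hxy
    have hst : s = t := mul_left_cancel₀ h4 h3
    subst hst
    rw [smul_right_injective _ (inv_ne_zero (mul_ne_zero h2 hx)) h1]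
  calc ∑ p : (Fin 5 → F) × F with p.2 ≠ 0,
        ‖∑ y ∈ A, g y * surfaceKernel e (p.1 - y) p.2‖ ^ 4
      = ∑ p : (Fin 5 → F) × F with p.2 ≠ 0, ((Fintype.card F : ℝ) ^ 10)⁻¹ * Φ (φ p) :=
        sum_congr rfl fun p hp =>
          norm_sum_mul_surfaceKernel_pow_four hF he A g p.1 (mem_filter.mp hp).2
    _ = ((Fintype.card F : ℝ) ^ 10)⁻¹ *
          ∑ p ∈ ({p | p.2 ≠ 0} : Finset ((Fin 5 → F) × F)).image φ, Φ p := by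
        rw [sum_image hinj, mul_sum]
    _ ≤ ((Fintype.card F : ℝ) ^ 10)⁻¹ * ∑ p, Φ p := by
        gcongr
        exact subset_univ _
    _ ≤ ((Fintype.card F : ℝ) ^ 10)⁻¹ * ((Fintype.card F : ℝ) ^ 6 * rightAngles A) := by
        gcongr
        exact sum_norm_extension_pow_four_le hF he A hg
    _ = ((Fintype.card F : ℝ) ^ 4)⁻¹ * rightAngles A := by
        field_simp

theorem surfaceKernel_zero_right {e : AddChar F ℂ} (he : e ≠ 1) (v : Fin 5 → F) :
    surfaceKernel e v 0 = if v = 0 then 1 else 0 := by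
  have hq : (Fintype.card F : ℂ) ≠ 0 := by simp
  rw [surfaceKernel]
  simp only [zero_mul, add_zero]
  simp_rw [dotProduct_comm v, sum_addChar_dotProduct he]
  split_ifs <;> simp [hq]

/-- The horizontal slice of `E` at height `a`. -/
def heightSlice (E : Finset ((Fin 5 → F) × F)) (a : F) : Finset (Fin 5 → F) := {y | (y, a) ∈ E}

omit [Field F] in
theorem sum_eq_sum_heightSlice {M : Type*} [AddCommMonoid M] (E : Finset ((Fin 5 → F) × F))
    (φ : (Fin 5 → F) × F → M) : ∑ x ∈ E, φ x = ∑ a, ∑ y ∈ heightSlice E a, φ (y, a) := by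
  rw [← sum_finset_product_right' E univ (heightSlice E) (by simp [heightSlice])]

theorem sum_norm_paraboloidTransform_sq_le {e : AddChar F ℂ} (he : e ≠ 1)
    (E : Finset ((Fin 5 → F) × F)) {g : (Fin 5 → F) × F → ℂ} (hg : ∀ x, ‖g x‖ ≤ 1) :
    ((Fintype.card F : ℝ) ^ 5)⁻¹ * ∑ y, ‖paraboloidTransform e E g y‖ ^ 2 ≤
      #E + ∑ a, ∑ x ∈ E with x.2 ≠ a,
        ‖∑ y ∈ heightSlice E a, conj (g (y, a)) * surfaceKernel e (x.1 - y) (x.2 - a)‖ := by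
  set R : ℝ := ((Fintype.card F : ℝ) ^ 5)⁻¹ * ∑ y, ‖paraboloidTransform e E g y‖ ^ 2 with hR
  have hR0 : 0 ≤ R := by positivity
  have hx : ∀ x ∈ E,
      ‖∑ x' ∈ E, g x * conj (g x') * surfaceKernel e (x.1 - x'.1) (x.2 - x'.2)‖ ≤
        1 + ∑ a, if x.2 ≠ a then
          ‖∑ y ∈ heightSlice E a, conj (g (y, a)) * surfaceKernel e (x.1 - y) (x.2 - a)‖ else 0 := by
    intro x _
    have hfactor : ∑ x' ∈ E, g x * conj (g x') * surfaceKernel e (x.1 - x'.1) (x.2 - x'.2) =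
        g x * ∑ a, ∑ y ∈ heightSlice E a, conj (g (y, a)) * surfaceKernel e (x.1 - y) (x.2 - a) := by
      rw [← sum_eq_sum_heightSlice E
        (fun x' => conj (g x') * surfaceKernel e (x.1 - x'.1) (x.2 - x'.2)), mul_sum]
      exact sum_congr rfl fun _ _ => mul_assoc _ _ _
    have hdiag :
        ‖∑ y ∈ heightSlice E x.2, conj (g (y, x.2)) * surfaceKernel e (x.1 - y) (x.2 - x.2)‖ ≤ 1 := by
      simp_rw [sub_self, surfaceKernel_zero_right he, sub_eq_zero, mul_ite, mul_one, mul_zero]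
      rw [sum_ite_eq]
      split_ifs
      · rw [RCLike.norm_conj]; exact hg _
      · simp
    rw [hfactor, norm_mul]
    refine (mul_le_of_le_one_left (norm_nonneg _) (hg x)).trans ((norm_sum_le _ _).trans ?_)
    rw [← add_sum_erase _ _ (mem_univ x.2)]
    refine add_le_add hdiag ?_
    rw [← sum_filter]
    refine le_of_eq (sum_congr ?_ fun _ _ => rfl)
    ext a; simp [eq_comm]
  calc R = ‖(R : ℂ)‖ := by rw [Complex.norm_real, Real.norm_of_nonneg hR0]
    _ ≤ ∑ x ∈ E, (1 + ∑ a, if x.2 ≠ a then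
          ‖∑ y ∈ heightSlice E a, conj (g (y, a)) * surfaceKernel e (x.1 - y) (x.2 - a)‖ else 0) := by
        rw [hR, sum_norm_paraboloidTransform_sq]
        exact (norm_sum_le _ _).trans (sum_le_sum hx)
    _ = _ := by
        rw [sum_add_distrib, sum_comm]
        simp [sum_filter]

end Kernel

section SmallSets

theorem sum_le_of_fourth_moment {ι : Type*} (T : Finset ι) (V : ι → ℝ) {M : ℝ} (hM : 0 < M) :
    ∑ x ∈ T, V x ≤ #T * M + (∑ x ∈ T, V x ^ 4) / M ^ 3 := by
  rw [← nsmul_eq_mul, ← sum_const, sum_div, ← sum_add_distrib]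
  refine sum_le_sum fun x _ => ?_
  rcases le_total (V x) M with h | h
  · have : 0 ≤ V x ^ 4 / M ^ 3 := by positivity
    linarith
  · have hV : 0 < V x := hM.trans_le h
    have : V x ≤ V x ^ 4 / M ^ 3 := by
      rw [le_div_iff₀ (by positivity), pow_succ' (V x) 3]
      gcongr
    linarith

theorem angle_bound_le {N ρ q : ℝ} (hN : 0 ≤ N) (hρ : 0 ≤ ρ) (hq : 0 < q) (hρq : ρ ≤ q ^ 3) :
    (q ^ 4)⁻¹ * (3 * N ^ 3 / q + 4 * q ^ 2 * N ^ 2) * (ρ ^ 2 * q ^ 2) ≤ 7 * (N + ρ) ^ 4 := by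
  have hexpand : (q ^ 4)⁻¹ * (3 * N ^ 3 / q + 4 * q ^ 2 * N ^ 2) * (ρ ^ 2 * q ^ 2) =
      3 * (N ^ 3 * ρ) * (ρ / q ^ 3) + 4 * (N ^ 2 * ρ ^ 2) := by
    field_simp
  have h1 : ρ / q ^ 3 ≤ 1 := (div_le_one (by positivity)).mpr hρq
  have h2 : N ^ 3 * ρ * (ρ / q ^ 3) ≤ N ^ 3 * ρ := mul_le_of_le_one_right (by positivity) h1
  have h3 : N ^ 3 * ρ + N ^ 2 * ρ ^ 2 ≤ (N + ρ) ^ 4 := by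
    have : (N + ρ) ^ 4 = N ^ 3 * ρ + N ^ 2 * ρ ^ 2 +
      (N ^ 4 + 3 * N ^ 3 * ρ + 5 * N ^ 2 * ρ ^ 2 + 4 * N * ρ ^ 3 + ρ ^ 4) := by ring
    rw [this]
    exact le_add_of_nonneg_right (by positivity)
  have h4 : 0 ≤ N ^ 3 * ρ := by positivity
  have h5 : 0 ≤ N ^ 2 * ρ ^ 2 := by positivity
  rw [hexpand]
  nlinarith

variable {F : Type} [Field F] [Fintype F] [DecidableEq F]

theorem sum_norm_sum_mul_surfaceKernel_le (hF : ringChar F ≠ 2) {e : AddChar F ℂ}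
    (he : e ≠ 1) {E : Finset ((Fin 5 → F) × F)} {Z : ℝ} (hZ : 0 < Z) (hE : (#E : ℝ) = Z ^ 4)
    (hE' : (#E : ℝ) ≤ (Fintype.card F : ℝ) ^ 4) (A : Finset (Fin 5 → F))
    {g : (Fin 5 → F) → ℂ} (hg : ∀ y, ‖g y‖ ≤ 1) (a : F) :
    ∑ x ∈ E with x.2 ≠ a, ‖∑ y ∈ A, g y * surfaceKernel e (x.1 - y) (x.2 - a)‖ ≤
      8 * Z * (#A + Z ^ 4 / Fintype.card F) := by
  set q : ℝ := (Fintype.card F : ℝ) with hq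
  have hq0 : 0 < q := by rw [hq]; exact_mod_cast Fintype.card_pos
  set ρ : ℝ := Z ^ 4 / q with hρ
  set N : ℝ := (#A : ℝ) with hN
  have hN0 : 0 ≤ N := by positivity
  have hρ0 : 0 < ρ := by positivity
  have hρq : ρ ≤ q ^ 3 := by
    rw [hρ, div_le_iff₀ hq0, ← hE]
    exact hE'.trans_eq (by ring)
  set V : (Fin 5 → F) × F → ℝ :=
    fun x => ‖∑ y ∈ A, g y * surfaceKernel e (x.1 - y) (x.2 - a)‖ with hV
  have hfourth : ∑ x ∈ E with x.2 ≠ a, V x ^ 4 ≤ 7 * (N + ρ) ^ 4 / Z ^ 8 := by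
    have hshift : ∑ x ∈ E with x.2 ≠ a, V x ^ 4 ≤ ∑ p : (Fin 5 → F) × F with p.2 ≠ 0,
        ‖∑ y ∈ A, g y * surfaceKernel e (p.1 - y) p.2‖ ^ 4 := by
      refine (sum_map {x ∈ E | x.2 ≠ a}
        (Equiv.prodCongr (Equiv.refl (Fin 5 → F)) (Equiv.subRight a)).toEmbedding
        (fun p => ‖∑ y ∈ A, g y * surfaceKernel e (p.1 - y) p.2‖ ^ 4)).symm.trans_le ?_
      refine sum_le_sum_of_subset_of_nonneg ?_ fun _ _ _ => by positivity
      intro p hp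
      obtain ⟨x, hx, rfl⟩ := mem_map.mp hp
      simpa [sub_eq_zero] using (mem_filter.mp hx).2
    refine hshift.trans ((sum_norm_sum_mul_surfaceKernel_pow_four_le hF he A hg).trans ?_)
    refine (mul_le_mul_of_nonneg_left (rightAngles_le hF he A) (by positivity)).trans ?_
    have hZ8 : Z ^ 8 = ρ ^ 2 * q ^ 2 := by rw [hρ]; field_simp
    rw [← hq, ← hN, hZ8, le_div_iff₀ (by positivity)]
    exact angle_bound_le hN0 hρ0.le hq0 hρq
  have hcard : (#{x ∈ E | x.2 ≠ a} : ℝ) ≤ Z ^ 4 := by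
    rw [← hE]; exact_mod_cast card_filter_le _ _
  have hM : 0 < (N + ρ) / Z ^ 3 := by positivity
  calc ∑ x ∈ E with x.2 ≠ a, V x
      ≤ #{x ∈ E | x.2 ≠ a} * ((N + ρ) / Z ^ 3) +
          (∑ x ∈ E with x.2 ≠ a, V x ^ 4) / ((N + ρ) / Z ^ 3) ^ 3 :=
        sum_le_of_fourth_moment _ _ hM
    _ ≤ Z ^ 4 * ((N + ρ) / Z ^ 3) +
          7 * (N + ρ) ^ 4 / Z ^ 8 / ((N + ρ) / Z ^ 3) ^ 3 := by gcongr
    _ = 8 * Z * (N + ρ) := by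
        have : N + ρ ≠ 0 := by positivity
        field_simp
        ring

theorem sum_norm_paraboloidTransform_sq_le_of_card_le (hF : ringChar F ≠ 2) {e : AddChar F ℂ}
    (he : e ≠ 1) {E : Finset ((Fin 5 → F) × F)} {Z : ℝ} (hZ : 1 ≤ Z) (hE : (#E : ℝ) = Z ^ 4)
    (hE' : (#E : ℝ) ≤ (Fintype.card F : ℝ) ^ 4) {g : (Fin 5 → F) × F → ℂ}
    (hg : ∀ x, ‖g x‖ ≤ 1) :
    ((Fintype.card F : ℝ) ^ 5)⁻¹ * ∑ y, ‖paraboloidTransform e E g y‖ ^ 2 ≤ 17 * Z ^ 5 := by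
  have hZ0 : 0 < Z := by linarith
  have hq : (Fintype.card F : ℝ) ≠ 0 := by simp
  have hslices : ∑ a, (#(heightSlice E a) : ℝ) = Z ^ 4 := by
    rw [← hE, card_eq_sum_ones E, sum_eq_sum_heightSlice E]
    push_cast
    simp
  refine (sum_norm_paraboloidTransform_sq_le he E hg).trans ?_
  calc (#E : ℝ) + ∑ a, ∑ x ∈ E with x.2 ≠ a,
        ‖∑ y ∈ heightSlice E a, conj (g (y, a)) * surfaceKernel e (x.1 - y) (x.2 - a)‖
      ≤ Z ^ 4 + ∑ a, 8 * Z * (#(heightSlice E a) + Z ^ 4 / Fintype.card F) := by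
        refine add_le_add hE.le (sum_le_sum fun a _ => ?_)
        exact sum_norm_sum_mul_surfaceKernel_le hF he hZ0 hE hE' _
          (fun y => (RCLike.norm_conj _).trans_le (hg _)) a
    _ = Z ^ 4 + 16 * Z ^ 5 := by
        rw [← mul_sum, sum_add_distrib, hslices, sum_const, card_univ, nsmul_eq_mul]
        field_simp
        ring
    _ ≤ 17 * Z ^ 5 := by
        have : Z ^ 4 ≤ Z ^ 5 := pow_le_pow_right₀ hZ (by norm_num)
        linarith

end SmallSets

section LevelSets

variable {F : Type} [Field F] [Fintype F]

theorem extOp_six_apply (e : AddChar F ℂ) (f : (Fin 5 → F) → ℂ) (x : (Fin 5 → F) × F) :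
    extOp (d := 6) e f x = ((Fintype.card F : ℂ) ^ 5)⁻¹ *
      ∑ y, f y * e (x.1 ⬝ᵥ y + x.2 * (y ⬝ᵥ y)) :=
  rfl

theorem exists_sum_norm_extOp_sq_le (e : AddChar F ℂ) (f : (Fin 5 → F) → ℂ)
    (E : Finset ((Fin 5 → F) × F)) :
    ∃ g : (Fin 5 → F) × F → ℂ, (∀ x, ‖g x‖ ≤ 1) ∧
      (∑ x ∈ E, ‖extOp (d := 6) e f x‖) ^ 2 ≤
        (((Fintype.card F : ℝ) ^ 5)⁻¹ * ∑ y, ‖paraboloidTransform e E g y‖ ^ 2) *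
          (((Fintype.card F : ℝ) ^ 5)⁻¹ * ∑ y, ‖f y‖ ^ 2) := by
  set h : (Fin 5 → F) × F → ℂ := fun x => extOp (d := 6) e f x with hh
  refine ⟨fun x => conj (h x) / ‖h x‖, fun x => ?_, ?_⟩
  · rw [norm_div, RCLike.norm_conj, Complex.norm_real, norm_norm]
    exact div_self_le_one _
  set g : (Fin 5 → F) × F → ℂ := fun x => conj (h x) / ‖h x‖ with hg
  have hgh : ∀ x, g x * h x = (‖h x‖ : ℂ) := by
    intro x
    by_cases hx : ‖h x‖ = 0
    · simp [hg, hx]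
    · have hx' : (‖h x‖ : ℂ) ≠ 0 := by exact_mod_cast hx
      rw [hg, div_mul_eq_mul_div, div_eq_iff hx', mul_comm, Complex.mul_conj,
        Complex.normSq_eq_norm_sq]
      push_cast
      ring
  have hS : ((∑ x ∈ E, ‖h x‖ : ℝ) : ℂ) =
      ((Fintype.card F : ℂ) ^ 5)⁻¹ * ∑ y, f y * paraboloidTransform e E g y := by
    push_cast
    simp_rw [← hgh, paraboloidTransform, mul_sum]
    rw [sum_comm]
    refine sum_congr rfl fun x _ => ?_
    rw [hh]
    simp only [extOp_six_apply, mul_sum]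
    exact sum_congr rfl fun y _ => by ring
  have hle : ∑ x ∈ E, ‖h x‖ ≤ ((Fintype.card F : ℝ) ^ 5)⁻¹ *
      ∑ y, ‖f y‖ * ‖paraboloidTransform e E g y‖ := by
    have hnorm : ∑ x ∈ E, ‖h x‖ = ‖((∑ x ∈ E, ‖h x‖ : ℝ) : ℂ)‖ := by
      rw [Complex.norm_real, Real.norm_of_nonneg (sum_nonneg fun _ _ => norm_nonneg _)]
    rw [hnorm, hS, norm_mul, norm_inv, norm_pow, Complex.norm_natCast]
    gcongr
    exact (norm_sum_le _ _).trans_eq (sum_congr rfl fun _ _ => norm_mul _ _)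
  calc (∑ x ∈ E, ‖h x‖) ^ 2
      ≤ (((Fintype.card F : ℝ) ^ 5)⁻¹ * ∑ y, ‖f y‖ * ‖paraboloidTransform e E g y‖) ^ 2 := by
        gcongr
    _ ≤ (((Fintype.card F : ℝ) ^ 5)⁻¹) ^ 2 *
          ((∑ y, ‖f y‖ ^ 2) * ∑ y, ‖paraboloidTransform e E g y‖ ^ 2) := by
        rw [mul_pow]
        gcongr
        exact sum_mul_sq_le_sq_mul_sq _ _ _
    _ = _ := by ring

theorem norm_extOp_le (e : AddChar F ℂ) (f : (Fin 5 → F) → ℂ) (x : (Fin 5 → F) × F) :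
    ‖extOp (d := 6) e f x‖ ^ 2 ≤ ((Fintype.card F : ℝ) ^ 5)⁻¹ * ∑ y, ‖f y‖ ^ 2 := by
  have hq : (Fintype.card F : ℝ) ≠ 0 := by simp
  have h : ‖∑ y, f y * e (x.1 ⬝ᵥ y + x.2 * (y ⬝ᵥ y))‖ ≤ ∑ y, ‖f y‖ :=
    (norm_sum_le _ _).trans_eq (sum_congr rfl fun y _ => by simp)
  rw [extOp_six_apply, norm_mul, norm_inv, norm_pow, Complex.norm_natCast, mul_pow]
  calc (((Fintype.card F : ℝ) ^ 5)⁻¹) ^ 2 * ‖∑ y, f y * e (x.1 ⬝ᵥ y + x.2 * (y ⬝ᵥ y))‖ ^ 2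
      ≤ (((Fintype.card F : ℝ) ^ 5)⁻¹) ^ 2 * (∑ y, ‖f y‖) ^ 2 := by gcongr
    _ ≤ (((Fintype.card F : ℝ) ^ 5)⁻¹) ^ 2 *
          ((Fintype.card F : ℝ) ^ 5 * ∑ y, ‖f y‖ ^ 2) := by
        gcongr
        exact sq_sum_le_card_mul_sum_sq.trans_eq (by simp)
    _ = _ := by field_simp

variable [DecidableEq F]

theorem sum_norm_extOp_sq {e : AddChar F ℂ} (he : e ≠ 1) (f : (Fin 5 → F) → ℂ) :
    ∑ x, ‖extOp (d := 6) e f x‖ ^ 2 =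
      Fintype.card F * (((Fintype.card F : ℝ) ^ 5)⁻¹ * ∑ y, ‖f y‖ ^ 2) := by
  have hq : (Fintype.card F : ℂ) ≠ 0 := by simp
  have hsq : ∀ z : ℂ, ((‖z‖ ^ 2 : ℝ) : ℂ) = z * conj z := fun z => by
    rw [Complex.mul_conj, Complex.normSq_eq_norm_sq]
  have hx : ∀ x : (Fin 5 → F) × F, ((‖extOp (d := 6) e f x‖ ^ 2 : ℝ) : ℂ) =
      (((Fintype.card F : ℂ) ^ 5)⁻¹) ^ 2 * ∑ y, ∑ y', f y * conj (f y') *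
        e (x.1 ⬝ᵥ (y - y') + x.2 * (y ⬝ᵥ y - y' ⬝ᵥ y')) := by
    intro x
    have hterm : ∀ y y' : Fin 5 → F, f y * conj (f y') *
        e (x.1 ⬝ᵥ (y - y') + x.2 * (y ⬝ᵥ y - y' ⬝ᵥ y')) =
          (f y * e (x.1 ⬝ᵥ y + x.2 * (y ⬝ᵥ y))) *
            conj (f y' * e (x.1 ⬝ᵥ y' + x.2 * (y' ⬝ᵥ y'))) := by
      intro y y'
      have : x.1 ⬝ᵥ (y - y') + x.2 * (y ⬝ᵥ y - y' ⬝ᵥ y') =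
          (x.1 ⬝ᵥ y + x.2 * (y ⬝ᵥ y)) + -(x.1 ⬝ᵥ y' + x.2 * (y' ⬝ᵥ y')) := by
        rw [dotProduct_sub]; ring
      rw [this, AddChar.map_add_eq_mul e _ (-_), AddChar.map_neg_eq_conj,
        map_mul (starRingEnd ℂ)]
      ring
    simp_rw [hterm, ← sum_mul_sum, ← map_sum (starRingEnd ℂ)]
    rw [hsq, extOp_six_apply, map_mul (starRingEnd ℂ), map_inv₀, map_pow, Complex.conj_natCast]
    ring
  have hmain : ((∑ x, ‖extOp (d := 6) e f x‖ ^ 2 : ℝ) : ℂ) =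
      ((Fintype.card F * (((Fintype.card F : ℝ) ^ 5)⁻¹ * ∑ y, ‖f y‖ ^ 2) : ℝ) : ℂ) := by
    rw [Complex.ofReal_sum]
    simp_rw [hx]
    rw [← mul_sum, sum_comm]
    have hy : ∀ y : Fin 5 → F, ∑ x : (Fin 5 → F) × F, ∑ y', f y * conj (f y') *
        e (x.1 ⬝ᵥ (y - y') + x.2 * (y ⬝ᵥ y - y' ⬝ᵥ y')) =
          (Fintype.card F : ℂ) ^ 6 * ((‖f y‖ ^ 2 : ℝ) : ℂ) := by
      intro y
      rw [sum_comm]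
      simp_rw [← mul_sum, sum_addChar_paraboloid he]
      rw [sum_eq_single_of_mem y (mem_univ _)]
      · rw [hsq]
        simp only [sub_self, and_self, if_true]
        ring
      · intro y' _ hy'
        simp [sub_eq_zero, hy'.symm]
    simp_rw [hy, ← mul_sum]
    push_cast
    field_simp
  exact_mod_cast hmain

theorem card_le_of_le_norm_extOp (hF : ringChar F ≠ 2) {e : AddChar F ℂ} (he : e ≠ 1)
    (f : (Fin 5 → F) → ℂ) {E : Finset ((Fin 5 → F) × F)} {t : ℝ} (ht : 0 < t)
    (hE : ∀ x ∈ E, t ≤ ‖extOp (d := 6) e f x‖) :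
    (#E : ℝ) ≤
      (17 * (((Fintype.card F : ℝ) ^ 5)⁻¹ * ∑ y, ‖f y‖ ^ 2) / t ^ 2) ^ ((4 : ℝ) / 3) := by
  set B : ℝ := ((Fintype.card F : ℝ) ^ 5)⁻¹ * ∑ y, ‖f y‖ ^ 2 with hB
  have hB0 : 0 ≤ B := by positivity
  rcases E.eq_empty_or_nonempty with rfl | hne
  · simpa using by positivity
  have hcard : (1 : ℝ) ≤ #E := by exact_mod_cast hne.card_pos
  obtain ⟨Z, hZ1, hZ4⟩ : ∃ Z : ℝ, 1 ≤ Z ∧ (#E : ℝ) = Z ^ 4 := by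
    refine ⟨(#E : ℝ) ^ ((1 : ℝ) / 4), Real.one_le_rpow hcard (by norm_num), ?_⟩
    rw [← Real.rpow_natCast, ← Real.rpow_mul (by positivity)]
    norm_num
  have hZ0 : 0 < Z := by linarith
  have hS : (∑ x ∈ E, ‖extOp (d := 6) e f x‖) ^ 2 ≤ 17 * Z ^ 5 * B := by
    rcases le_or_gt (#E : ℝ) ((Fintype.card F : ℝ) ^ 4) with hsmall | hlarge
    · obtain ⟨g, hg, hle⟩ := exists_sum_norm_extOp_sq_le e f E
      exact hle.trans (mul_le_mul_of_nonneg_right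
        (sum_norm_paraboloidTransform_sq_le_of_card_le hF he hZ1 hZ4 hsmall hg) hB0)
    · have hqZ : (Fintype.card F : ℝ) ≤ Z := by
        rw [hZ4] at hlarge
        exact (lt_of_pow_lt_pow_left₀ 4 hZ0.le hlarge).le
      calc (∑ x ∈ E, ‖extOp (d := 6) e f x‖) ^ 2
          ≤ #E * ∑ x ∈ E, ‖extOp (d := 6) e f x‖ ^ 2 := sq_sum_le_card_mul_sum_sq
        _ ≤ #E * ∑ x, ‖extOp (d := 6) e f x‖ ^ 2 := by
            gcongr
            exact subset_univ _
        _ = Z ^ 4 * (Fintype.card F * B) := by rw [sum_norm_extOp_sq he, hZ4]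
        _ ≤ Z ^ 4 * (Z * B) := by gcongr
        _ ≤ 17 * Z ^ 5 * B := by
            have : 0 ≤ Z ^ 5 * B := by positivity
            linarith
  have hlow : (Z ^ 4 * t) ^ 2 ≤ (∑ x ∈ E, ‖extOp (d := 6) e f x‖) ^ 2 := by
    gcongr
    rw [← hZ4, ← nsmul_eq_mul]
    exact card_nsmul_le_sum _ _ _ hE
  have hZ3 : Z ^ 3 ≤ 17 * B / t ^ 2 := by
    rw [le_div_iff₀ (by positivity)]
    refine le_of_mul_le_mul_left ?_ (pow_pos hZ0 5)
    linarith [hlow.trans hS, show (Z ^ 4 * t) ^ 2 = Z ^ 5 * (Z ^ 3 * t ^ 2) by ring]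
  calc (#E : ℝ) = (Z ^ 3) ^ ((4 : ℝ) / 3) := by
        rw [hZ4, ← Real.rpow_natCast, ← Real.rpow_natCast, ← Real.rpow_mul hZ0.le]
        norm_num
    _ ≤ _ := by gcongr

end LevelSets

theorem sum_rpow_le_of_card_superlevel_le {ι : Type*} [Fintype ι] {h : ι → ℝ} {N K p ε : ℝ}
    (hN : 0 < N) (hp : 0 ≤ p) (hε : 0 < ε) (h0 : ∀ x, 0 ≤ h x) (hle : ∀ x, h x ≤ N)
    (hcard : ∀ t, 0 < t → (#{x | t ≤ h x} : ℝ) ≤ K * (N / t) ^ p) :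
    ∑ x, h x ^ (p + ε) ≤ K * 2 ^ p * (1 - ((2 : ℝ) ^ ε)⁻¹)⁻¹ * N ^ (p + ε) := by
  have hK : 0 ≤ K := by
    have := hcard N hN
    rw [div_self hN.ne', Real.one_rpow, mul_one] at this
    exact (Nat.cast_nonneg _).trans this
  have hb : ∀ x, ∃ j : ℕ, 0 < h x → N / 2 ^ (j + 1) ≤ h x ∧ h x ≤ N / 2 ^ j := by
    intro x
    by_cases hx : 0 < h x
    · obtain ⟨j, hj1, hj2⟩ := exists_nat_pow_near_of_lt_one (div_pos hx hN)
        ((div_le_one hN).mpr (hle x)) (y := (1 / 2 : ℝ)) (by norm_num) (by norm_num)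
      refine ⟨j, fun _ => ⟨?_, ?_⟩⟩
      · rw [lt_div_iff₀ hN] at hj1
        exact le_of_eq_of_le (by rw [one_div, inv_pow]; ring) hj1.le
      · rw [div_le_iff₀ hN] at hj2
        exact hj2.trans_eq (by rw [one_div, inv_pow]; ring)
    · exact ⟨0, fun h => absurd h hx⟩
  choose j hj using hb
  set J : ℕ := univ.sup j + 1 with hJ
  have h2ε : 1 < (2 : ℝ) ^ ε := Real.one_lt_rpow (by norm_num) hε
  have hpt : ∀ x, h x ^ (p + ε) ≤
      ∑ i ∈ range J, if N / 2 ^ (i + 1) ≤ h x then (N / 2 ^ i) ^ (p + ε) else 0 := by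
    intro x
    have hnonneg : ∀ i ∈ range J,
        0 ≤ if N / 2 ^ (i + 1) ≤ h x then (N / 2 ^ i) ^ (p + ε) else 0 := by
      intro i _
      split_ifs <;> positivity
    rcases (h0 x).eq_or_lt with hx | hx
    · rw [← hx, Real.zero_rpow (by positivity)]
      rw [← hx] at hnonneg
      exact sum_nonneg hnonneg
    · refine le_trans ?_ (single_le_sum hnonneg
        (mem_range.mpr (Nat.lt_succ_of_le (le_sup (mem_univ x)))))
      rw [if_pos (hj x hx).1]
      exact Real.rpow_le_rpow (h0 x) (hj x hx).2 (by positivity)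
  have hscale : ∀ i : ℕ, K * (N / (N / 2 ^ (i + 1))) ^ p * (N / 2 ^ i) ^ (p + ε) =
      K * 2 ^ p * N ^ (p + ε) * (((2 : ℝ) ^ ε)⁻¹) ^ i := by
    intro i
    have h2i : (0 : ℝ) < 2 ^ i := by positivity
    have hswap : ((2 : ℝ) ^ i) ^ ε = ((2 : ℝ) ^ ε) ^ i := by
      rw [← Real.rpow_natCast, ← Real.rpow_natCast, ← Real.rpow_mul (by norm_num),
        ← Real.rpow_mul (by norm_num), mul_comm]
    rw [div_div_cancel₀ hN.ne', pow_succ', Real.mul_rpow (by norm_num) h2i.le,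
      Real.div_rpow hN.le h2i.le, Real.rpow_add h2i, hswap, inv_pow]
    have : ((2 : ℝ) ^ i) ^ p ≠ 0 := by positivity
    field_simp
  calc ∑ x, h x ^ (p + ε)
      ≤ ∑ x, ∑ i ∈ range J, if N / 2 ^ (i + 1) ≤ h x then (N / 2 ^ i) ^ (p + ε) else 0 :=
        sum_le_sum fun x _ => hpt x
    _ = ∑ i ∈ range J, (#{x | N / 2 ^ (i + 1) ≤ h x} : ℝ) * (N / 2 ^ i) ^ (p + ε) := by
        rw [sum_comm]
        refine sum_congr rfl fun i _ => ?_
        rw [← sum_filter, sum_const, nsmul_eq_mul]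
    _ ≤ ∑ i ∈ range J, K * 2 ^ p * N ^ (p + ε) * (((2 : ℝ) ^ ε)⁻¹) ^ i := by
        refine sum_le_sum fun i _ => ?_
        rw [← hscale]
        gcongr
        exact hcard _ (by positivity)
    _ ≤ K * 2 ^ p * N ^ (p + ε) * (1 - ((2 : ℝ) ^ ε)⁻¹)⁻¹ := by
        rw [← mul_sum]
        gcongr
        have hr0 : 0 ≤ ((2 : ℝ) ^ ε)⁻¹ := by positivity
        have hr1 : ((2 : ℝ) ^ ε)⁻¹ < 1 := inv_lt_one_of_one_lt₀ h2ε
        rw [← tsum_geometric_of_lt_one hr0 hr1]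
        exact (summable_geometric_of_lt_one hr0 hr1).sum_le_tsum _ fun _ _ => by positivity
    _ = _ := by ring

/-- Let `d = 6`. For every `ε > 0` there is `C(ε) > 0` such that for every finite field `F`
of odd characteristic, every nontrivial additive character `e` of `F`, and every
`f : P → ℂ` on the paraboloid `P ⊆ F^6`, one has
`‖(f dσ)^∨‖_{L^{8/3+ε}(F^6)} ≤ C(ε) ‖f‖_{L^2(P,dσ)}`. -/
theorem stmt1 (ε : ℝ) (hε : 0 < ε) :
    ∃ C : ℝ, 0 < C ∧
      ∀ (F : Type) [Field F] [Fintype F], ringChar F ≠ 2 →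
      ∀ (e : AddChar F ℂ), e ≠ 1 →
      ∀ f : (Fin (6 - 1) → F) → ℂ,
        (∑ x : (Fin (6 - 1) → F) × F,
            ‖extOp (d := 6) e f x‖ ^ ((8 : ℝ) / 3 + ε)) ^ (((8 : ℝ) / 3 + ε)⁻¹)
          ≤ C * (((Fintype.card F : ℝ) ^ (6 - 1))⁻¹ *
              ∑ y : Fin (6 - 1) → F, ‖f y‖ ^ 2) ^ ((1 : ℝ) / 2) := by
  classical
  set K : ℝ := 17 ^ ((4 : ℝ) / 3) * 2 ^ ((8 : ℝ) / 3) * (1 - ((2 : ℝ) ^ ε)⁻¹)⁻¹ with hK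
  have hK0 : 0 < K := by
    have h2ε : ((2 : ℝ) ^ ε)⁻¹ < 1 :=
      inv_lt_one_of_one_lt₀ (Real.one_lt_rpow (by norm_num) hε)
    have := inv_pos.mpr (sub_pos.mpr h2ε)
    positivity
  refine ⟨K ^ (((8 : ℝ) / 3 + ε)⁻¹), by positivity, ?_⟩
  intro F _ _ hF e he (f : (Fin 5 → F) → ℂ)
  change (∑ x : (Fin 5 → F) × F,
      ‖extOp (d := 6) e f x‖ ^ ((8 : ℝ) / 3 + ε)) ^ (((8 : ℝ) / 3 + ε)⁻¹) ≤
    K ^ (((8 : ℝ) / 3 + ε)⁻¹) *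
      (((Fintype.card F : ℝ) ^ 5)⁻¹ * ∑ y : Fin 5 → F, ‖f y‖ ^ 2) ^ ((1 : ℝ) / 2)
  have hle := norm_extOp_le e f
  have hcard := fun (t : ℝ) (ht : 0 < t) =>
    card_le_of_le_norm_extOp hF he f (E := {x | t ≤ ‖extOp (d := 6) e f x‖}) ht (by simp)
  set B : ℝ := ((Fintype.card F : ℝ) ^ 5)⁻¹ * ∑ y : Fin 5 → F, ‖f y‖ ^ 2 with hB
  have hB0 : 0 ≤ B := by positivity
  have hr0 : (8 : ℝ) / 3 + ε ≠ 0 := by positivity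
  rw [← Real.sqrt_eq_rpow]
  rcases hB0.eq_or_lt with hB' | hB'
  · have hzero : ∀ x, ‖extOp (d := 6) e f x‖ = 0 := fun x =>
      pow_eq_zero_iff two_ne_zero |>.mp (le_antisymm (hB' ▸ hle x) (by positivity))
    simp_rw [hzero]
    rw [Real.zero_rpow hr0, sum_const_zero, Real.zero_rpow (inv_ne_zero hr0)]
    positivity
  have hN : 0 < √B := Real.sqrt_pos.mpr hB'
  have hsum := sum_rpow_le_of_card_superlevel_le (K := 17 ^ ((4 : ℝ) / 3)) (p := 8 / 3) hN
    (by norm_num) hε (fun x => norm_nonneg (extOp (d := 6) e f x))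
    (fun x => Real.le_sqrt_of_sq_le (hle x)) (by
      intro t ht
      refine (hcard t ht).trans_eq ?_
      have : 17 * B / t ^ 2 = 17 * (√B / t) ^ 2 := by
        rw [div_pow, Real.sq_sqrt hB0, mul_div_assoc]
      rw [this, Real.mul_rpow (by norm_num) (by positivity), ← Real.rpow_natCast,
        ← Real.rpow_mul (by positivity)]
      norm_num)
  calc _ ≤ (K * √B ^ ((8 : ℝ) / 3 + ε)) ^ (((8 : ℝ) / 3 + ε)⁻¹) := by
        gcongr
    _ = K ^ (((8 : ℝ) / 3 + ε)⁻¹) * √B := by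
        rw [Real.mul_rpow hK0.le (by positivity), Real.rpow_rpow_inv hN.le hr0]
end
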